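/- (Completeness of the cut-free primitive recursive ω-rule.) For every sentence A of arithmetic: if A is true in ℕ then there exists a ∈ C_prec^- with End(a) = {A} such that π(a) is a primitive recursive cut-free ω-proof; conversely, if there exists a ∈ C_prec^- with End(a) = {A} then A is true. Hence thm(C_prec^-) is exactly the set of true arithmetical sentences. -/

import Mathlib

namespace Shoen

/-- Kleene application: value of the `e`-th partial recursive function at `n`,
in the standard numbering via `Nat.Partrec.Code`. -/
def peval (e n : ℕ) : Part ℕ := (Denumerable.ofNat Nat.Partrec.Code e).eval n

/-- `e` is an index of a (total) primitive recursive function. -/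
def PrimIndex (e : ℕ) : Prop := ∃ f : ℕ → ℕ, Nat.Primrec f ∧ ∀ n, peval e n = Part.some (f n)

/-- Kleene's relation `<_O`. -/
inductive KLt : ℕ → ℕ → Prop
  | base : KLt 1 2
  | step {a b : ℕ} : KLt a b → KLt b (2 ^ b)
  | lim {e : ℕ} (h : ∀ n, (peval e n).Dom)
      (hm : ∀ n, KLt ((peval e n).get (h n)) ((peval e (n + 1)).get (h (n + 1))))
      (n : ℕ) : KLt ((peval e n).get (h n)) (3 * 5 ^ e)
  | trans {a b c : ℕ} : KLt a b → KLt b c → KLt a c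

/-- Kleene's `O`. -/
def KO (a : ℕ) : Prop := KLt a (2 ^ a)

/-- The auxiliary relation `<'_O`. -/
inductive KLt' : ℕ → ℕ → Prop
  | base : KLt' 1 2
  | step {a b : ℕ} : KLt' a b → KLt' b (2 ^ b)
  | lim {e n x : ℕ} : x ∈ peval e n → KLt' x (3 * 5 ^ e)
  | trans {a b c : ℕ} : KLt' a b → KLt' b c → KLt' a c

/-- The inductive characterization `O'` of Kleene's `O`. -/
inductive KO' : ℕ → Prop
  | one : KO' 1
  | step {a : ℕ} : KO' a → KO' (2 ^ a)
  | lim {e : ℕ} (h : ∀ n, (peval e n).Dom)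
      (hm : ∀ n, KLt' ((peval e n).get (h n)) ((peval e (n + 1)).get (h (n + 1)))) :
      KO' (3 * 5 ^ e)



/-! ### Syntax of first order arithmetic (negation normal form) -/

/-- Terms of the language `0,1,+,×,=`, with de Bruijn variables. -/
inductive Trm : Type
  | var : ℕ → Trm
  | zero : Trm
  | one : Trm
  | add : Trm → Trm → Trm
  | mul : Trm → Trm → Trm
deriving DecidableEq

/-- Formulas in negation normal form: literals (atomic and negated atomic
formulas) combined by `∧, ∨, ∀, ∃` (de Bruijn binders). -/
inductive Fml : Type
  | eq : Trm → Trm → Fml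
  | ne : Trm → Trm → Fml
  | and : Fml → Fml → Fml
  | or : Fml → Fml → Fml
  | all : Fml → Fml
  | ex : Fml → Fml
deriving DecidableEq

/-- All free variables of a term are `< k`. -/
def Trm.cu : Trm → ℕ → Bool
  | .var i, k => decide (i < k)
  | .zero, _ => true
  | .one, _ => true
  | .add s t, k => s.cu k && t.cu k
  | .mul s t, k => s.cu k && t.cu k

/-- All free variables of a formula are `< k`. -/
def Fml.cu : Fml → ℕ → Bool
  | .eq s t, k => s.cu k && t.cu k
  | .ne s t, k => s.cu k && t.cu k
  | .and A B, k => A.cu k && B.cu k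
  | .or A B, k => A.cu k && B.cu k
  | .all A, k => A.cu (k + 1)
  | .ex A, k => A.cu (k + 1)

/-- A sentence is a closed formula. -/
abbrev Sentence : Type := { A : Fml // A.cu 0 = true }

/-- Value of a term under an environment. -/
def Trm.val (ρ : ℕ → ℕ) : Trm → ℕ
  | .var i => ρ i
  | .zero => 0
  | .one => 1
  | .add s t => s.val ρ + t.val ρ
  | .mul s t => s.val ρ * t.val ρ

/-- Extend an environment by a value for variable `0`. -/
def consEnv (n : ℕ) (ρ : ℕ → ℕ) : ℕ → ℕ
  | 0 => n
  | k + 1 => ρ k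

/-- Satisfaction in the standard model `ℕ`. -/
def Fml.Sat (ρ : ℕ → ℕ) : Fml → Prop
  | .eq s t => s.val ρ = t.val ρ
  | .ne s t => s.val ρ ≠ t.val ρ
  | .and A B => A.Sat ρ ∧ B.Sat ρ
  | .or A B => A.Sat ρ ∨ B.Sat ρ
  | .all A => ∀ n : ℕ, A.Sat (consEnv n ρ)
  | .ex A => ∃ n : ℕ, A.Sat (consEnv n ρ)

/-- Truth of a sentence in the standard model. -/
def sentTrue (A : Sentence) : Prop := A.1.Sat (fun _ => 0)

/-- Substitution of a closed term `t` for variable `k` in a term. -/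
def Trm.sub (t : Trm) (k : ℕ) : Trm → Trm
  | .var i => if i = k then t else if k < i then .var (i - 1) else .var i
  | .zero => .zero
  | .one => .one
  | .add s u => .add (Trm.sub t k s) (Trm.sub t k u)
  | .mul s u => .mul (Trm.sub t k s) (Trm.sub t k u)

/-- Substitution of a closed term `t` for variable `k` in a formula. -/
def Fml.sub (t : Trm) : Fml → ℕ → Fml
  | .eq s u, k => .eq (Trm.sub t k s) (Trm.sub t k u)
  | .ne s u, k => .ne (Trm.sub t k s) (Trm.sub t k u)
  | .and A B, k => .and (A.sub t k) (B.sub t k)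
  | .or A B, k => .or (A.sub t k) (B.sub t k)
  | .all A, k => .all (A.sub t (k + 1))
  | .ex A, k => .ex (A.sub t (k + 1))

/-- The numeral `n̄`. -/
def numeral : ℕ → Trm
  | 0 => .zero
  | n + 1 => .add (numeral n) .one

theorem Trm.cu_mono : ∀ (t : Trm) {j k : ℕ}, j ≤ k → t.cu j = true → t.cu k = true := by
  intro t
  induction t with
  | var i =>
    intro j k h ht
    simp only [Trm.cu, decide_eq_true_eq] at *
    omega
  | zero => intros; rfl
  | one => intros; rfl
  | add s u ihs ihu =>
    intro j k h ht
    simp only [Trm.cu, Bool.and_eq_true] at *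
    exact ⟨ihs h ht.1, ihu h ht.2⟩
  | mul s u ihs ihu =>
    intro j k h ht
    simp only [Trm.cu, Bool.and_eq_true] at *
    exact ⟨ihs h ht.1, ihu h ht.2⟩

theorem Trm.cu_sub : ∀ (s : Trm) {k : ℕ} {t : Trm},
    t.cu 0 = true → s.cu (k + 1) = true → (Trm.sub t k s).cu k = true := by
  intro s
  induction s with
  | var i =>
    intro k t ht hs
    simp only [Trm.cu, decide_eq_true_eq] at hs
    simp only [Trm.sub]
    by_cases h : i = k
    · rw [if_pos h]
      exact Trm.cu_mono t (Nat.zero_le k) ht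
    · have h2 : ¬ k < i := by omega
      rw [if_neg h, if_neg h2]
      simp only [Trm.cu, decide_eq_true_eq]
      omega
  | zero => intros; rfl
  | one => intros; rfl
  | add s u ihs ihu =>
    intro k t ht hs
    simp only [Trm.cu, Bool.and_eq_true] at hs
    simp only [Trm.sub, Trm.cu, Bool.and_eq_true]
    exact ⟨ihs ht hs.1, ihu ht hs.2⟩
  | mul s u ihs ihu =>
    intro k t ht hs
    simp only [Trm.cu, Bool.and_eq_true] at hs
    simp only [Trm.sub, Trm.cu, Bool.and_eq_true]
    exact ⟨ihs ht hs.1, ihu ht hs.2⟩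

theorem Fml.cu_sub : ∀ (A : Fml) {k : ℕ} {t : Trm},
    t.cu 0 = true → A.cu (k + 1) = true → (A.sub t k).cu k = true := by
  intro A
  induction A with
  | eq s u =>
    intro k t ht hA
    simp only [Fml.cu, Bool.and_eq_true] at hA
    simp only [Fml.sub, Fml.cu, Bool.and_eq_true]
    exact ⟨Trm.cu_sub s ht hA.1, Trm.cu_sub u ht hA.2⟩
  | ne s u =>
    intro k t ht hA
    simp only [Fml.cu, Bool.and_eq_true] at hA
    simp only [Fml.sub, Fml.cu, Bool.and_eq_true]
    exact ⟨Trm.cu_sub s ht hA.1, Trm.cu_sub u ht hA.2⟩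
  | and A B ihA ihB =>
    intro k t ht h
    simp only [Fml.cu, Bool.and_eq_true] at h
    simp only [Fml.sub, Fml.cu, Bool.and_eq_true]
    exact ⟨ihA ht h.1, ihB ht h.2⟩
  | or A B ihA ihB =>
    intro k t ht h
    simp only [Fml.cu, Bool.and_eq_true] at h
    simp only [Fml.sub, Fml.cu, Bool.and_eq_true]
    exact ⟨ihA ht h.1, ihB ht h.2⟩
  | all A ihA =>
    intro k t ht h
    simp only [Fml.cu] at h
    simp only [Fml.sub, Fml.cu]
    exact ihA ht h
  | ex A ihA =>
    intro k t ht h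
    simp only [Fml.cu] at h
    simp only [Fml.sub, Fml.cu]
    exact ihA ht h

theorem numeral_cu : ∀ n : ℕ, (numeral n).cu 0 = true := by
  intro n
  induction n with
  | zero => rfl
  | succ n ih => simp [numeral, Trm.cu, ih]

/-- Negation (de Morgan dual) of a formula in negation normal form. -/
def Fml.neg : Fml → Fml
  | .eq s t => .ne s t
  | .ne s t => .eq s t
  | .and A B => .or A.neg B.neg
  | .or A B => .and A.neg B.neg
  | .all A => .ex A.neg
  | .ex A => .all A.neg

theorem Fml.cu_neg : ∀ (A : Fml) {k : ℕ}, A.cu k = true → A.neg.cu k = true := by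
  intro A
  induction A with
  | eq s u => intro k h; simpa [Fml.cu, Fml.neg] using h
  | ne s u => intro k h; simpa [Fml.cu, Fml.neg] using h
  | and A B ihA ihB =>
    intro k h
    simp only [Fml.cu, Bool.and_eq_true] at h
    simp only [Fml.neg, Fml.cu, Bool.and_eq_true]
    exact ⟨ihA h.1, ihB h.2⟩
  | or A B ihA ihB =>
    intro k h
    simp only [Fml.cu, Bool.and_eq_true] at h
    simp only [Fml.neg, Fml.cu, Bool.and_eq_true]
    exact ⟨ihA h.1, ihB h.2⟩
  | all A ihA =>
    intro k h
    simp only [Fml.cu] at h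
    simp only [Fml.neg, Fml.cu]
    exact ihA h
  | ex A ihA =>
    intro k h
    simp only [Fml.cu] at h
    simp only [Fml.neg, Fml.cu]
    exact ihA h

/-- Conjunction of sentences. -/
def sAnd (A B : Sentence) : Sentence :=
  ⟨.and A.1 B.1, by simp [Fml.cu, A.2, B.2]⟩

/-- Disjunction of sentences. -/
def sOr (A B : Sentence) : Sentence :=
  ⟨.or A.1 B.1, by simp [Fml.cu, A.2, B.2]⟩

/-- Negation of a sentence. -/
def sNeg (A : Sentence) : Sentence := ⟨A.1.neg, Fml.cu_neg A.1 A.2⟩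

/-- The sentence `∀x A(x)`, for `A` with (at most) one free variable. -/
def sAll (A : Fml) (h : A.cu 1 = true) : Sentence := ⟨.all A, by simpa [Fml.cu] using h⟩

/-- The sentence `∃x A(x)`, for `A` with (at most) one free variable. -/
def sEx (A : Fml) (h : A.cu 1 = true) : Sentence := ⟨.ex A, by simpa [Fml.cu] using h⟩

/-- The instance `A(n̄)` of a formula `A` with one free variable. -/
def sInst (A : Fml) (h : A.cu 1 = true) (n : ℕ) : Sentence :=
  ⟨A.sub (numeral n) 0, Fml.cu_sub A (numeral_cu n) h⟩

/-- Literals: atomic and negated atomic formulas. -/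
def Fml.isLiteral : Fml → Bool
  | .eq _ _ => true
  | .ne _ _ => true
  | _ => false

/-- Quantifier free formulas. -/
def Fml.qf : Fml → Bool
  | .eq _ _ => true
  | .ne _ _ => true
  | .and A B => A.qf && B.qf
  | .or A B => A.qf && B.qf
  | .all _ => false
  | .ex _ => false

/-- An axiom is a sequent containing a true closed literal. -/
def IsAxiom (Γ : Finset Sentence) : Prop :=
  ∃ A ∈ Γ, A.1.isLiteral = true ∧ sentTrue A

/-- A sequent is true if some member is true. -/
def SeqTrue (Γ : Finset Sentence) : Prop := ∃ A ∈ Γ, sentTrue A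


/-! ### A primitive recursive Gödel numbering of terms, sentences and sequents -/

/-- Gödel number of a term. -/
def Trm.enc : Trm → ℕ
  | .var i => 5 * i
  | .zero => 1
  | .one => 2
  | .add s t => 5 * Nat.pair s.enc t.enc + 3
  | .mul s t => 5 * Nat.pair s.enc t.enc + 4

/-- Fuelled decoding of terms. -/
def Trm.dec : ℕ → ℕ → Option Trm
  | 0, _ => none
  | fuel + 1, n =>
    if n % 5 = 0 then some (.var (n / 5))
    else if n % 5 = 1 then some .zero
    else if n % 5 = 2 then some .one
    else if n % 5 = 3 then
      match Trm.dec fuel (n / 5).unpair.1, Trm.dec fuel (n / 5).unpair.2 with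
      | some s, some t => some (.add s t)
      | _, _ => none
    else
      match Trm.dec fuel (n / 5).unpair.1, Trm.dec fuel (n / 5).unpair.2 with
      | some s, some t => some (.mul s t)
      | _, _ => none

theorem Trm.dec_enc : ∀ (t : Trm) (fuel : ℕ), t.enc < fuel → Trm.dec fuel t.enc = some t := by
  intro t
  induction t with
  | var i =>
    intro fuel h
    match fuel with
    | f + 1 =>
      have h0 : (5 * i) % 5 = 0 := by omega
      have h1 : (5 * i) / 5 = i := by omega
      simp [Trm.dec, Trm.enc, h0, h1]
  | zero =>
    intro fuel h
    match fuel with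
    | f + 1 => simp [Trm.dec, Trm.enc]
  | one =>
    intro fuel h
    match fuel with
    | f + 1 => simp [Trm.dec, Trm.enc]
  | add s u ihs ihu =>
    intro fuel h
    match fuel with
    | f + 1 =>
      simp only [Trm.enc] at h ⊢
      set p := Nat.pair s.enc u.enc with hp
      have h0 : (5 * p + 3) % 5 = 3 := by omega
      have h1 : (5 * p + 3) / 5 = p := by omega
      have hs : s.enc < f := by
        have := Nat.left_le_pair s.enc u.enc
        omega
      have hu : u.enc < f := by
        have := Nat.right_le_pair s.enc u.enc
        omega
      simp only [Trm.dec, h0, h1]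
      rw [hp, Nat.unpair_pair, ihs f hs, ihu f hu]
      simp
  | mul s u ihs ihu =>
    intro fuel h
    match fuel with
    | f + 1 =>
      simp only [Trm.enc] at h ⊢
      set p := Nat.pair s.enc u.enc with hp
      have h0 : (5 * p + 4) % 5 = 4 := by omega
      have h1 : (5 * p + 4) / 5 = p := by omega
      have hs : s.enc < f := by
        have := Nat.left_le_pair s.enc u.enc
        omega
      have hu : u.enc < f := by
        have := Nat.right_le_pair s.enc u.enc
        omega
      simp only [Trm.dec, h0, h1]
      rw [hp, Nat.unpair_pair, ihs f hs, ihu f hu]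
      simp

instance : Encodable Trm :=
  ⟨Trm.enc, fun n => Trm.dec (n + 1) n, fun t => Trm.dec_enc t _ (Nat.lt_succ_self _)⟩

/-- Gödel number of a formula. -/
def Fml.enc : Fml → ℕ
  | .eq s t => 6 * Nat.pair s.enc t.enc
  | .ne s t => 6 * Nat.pair s.enc t.enc + 1
  | .and A B => 6 * Nat.pair A.enc B.enc + 2
  | .or A B => 6 * Nat.pair A.enc B.enc + 3
  | .all A => 6 * A.enc + 4
  | .ex A => 6 * A.enc + 5

/-- Fuelled decoding of formulas. -/
def Fml.dec : ℕ → ℕ → Option Fml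
  | 0, _ => none
  | fuel + 1, n =>
    if n % 6 = 0 then
      match Encodable.decode (α := Trm) (n / 6).unpair.1,
            Encodable.decode (α := Trm) (n / 6).unpair.2 with
      | some s, some t => some (.eq s t)
      | _, _ => none
    else if n % 6 = 1 then
      match Encodable.decode (α := Trm) (n / 6).unpair.1,
            Encodable.decode (α := Trm) (n / 6).unpair.2 with
      | some s, some t => some (.ne s t)
      | _, _ => none
    else if n % 6 = 2 then
      match Fml.dec fuel (n / 6).unpair.1, Fml.dec fuel (n / 6).unpair.2 with
      | some A, some B => some (.and A B)
      | _, _ => none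
    else if n % 6 = 3 then
      match Fml.dec fuel (n / 6).unpair.1, Fml.dec fuel (n / 6).unpair.2 with
      | some A, some B => some (.or A B)
      | _, _ => none
    else if n % 6 = 4 then
      match Fml.dec fuel (n / 6) with
      | some A => some (.all A)
      | none => none
    else
      match Fml.dec fuel (n / 6) with
      | some A => some (.ex A)
      | none => none

theorem Fml.dec_enc : ∀ (A : Fml) (fuel : ℕ), A.enc < fuel → Fml.dec fuel A.enc = some A := by
  intro A
  induction A with
  | eq s u =>
    intro fuel h
    match fuel with
    | f + 1 =>
      simp only [Fml.enc] at h ⊢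
      set p := Nat.pair s.enc u.enc with hp
      have h0 : (6 * p) % 6 = 0 := by omega
      have h1 : (6 * p) / 6 = p := by omega
      have hds : Encodable.decode (α := Trm) s.enc = some s := Encodable.encodek s
      have hdu : Encodable.decode (α := Trm) u.enc = some u := Encodable.encodek u
      simp only [Fml.dec, h0, h1]
      rw [hp, Nat.unpair_pair, hds, hdu]
      simp
  | ne s u =>
    intro fuel h
    match fuel with
    | f + 1 =>
      simp only [Fml.enc] at h ⊢
      set p := Nat.pair s.enc u.enc with hp
      have h0 : (6 * p + 1) % 6 = 1 := by omega
      have h1 : (6 * p + 1) / 6 = p := by omega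
      have hds : Encodable.decode (α := Trm) s.enc = some s := Encodable.encodek s
      have hdu : Encodable.decode (α := Trm) u.enc = some u := Encodable.encodek u
      simp only [Fml.dec, h0, h1]
      rw [hp, Nat.unpair_pair, hds, hdu]
      simp
  | and A B ihA ihB =>
    intro fuel h
    match fuel with
    | f + 1 =>
      simp only [Fml.enc] at h ⊢
      set p := Nat.pair A.enc B.enc with hp
      have h0 : (6 * p + 2) % 6 = 2 := by omega
      have h1 : (6 * p + 2) / 6 = p := by omega
      have hA : A.enc < f := by
        have := Nat.left_le_pair A.enc B.enc
        omega
      have hB : B.enc < f := by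
        have := Nat.right_le_pair A.enc B.enc
        omega
      simp only [Fml.dec, h0, h1]
      rw [hp, Nat.unpair_pair, ihA f hA, ihB f hB]
      simp
  | or A B ihA ihB =>
    intro fuel h
    match fuel with
    | f + 1 =>
      simp only [Fml.enc] at h ⊢
      set p := Nat.pair A.enc B.enc with hp
      have h0 : (6 * p + 3) % 6 = 3 := by omega
      have h1 : (6 * p + 3) / 6 = p := by omega
      have hA : A.enc < f := by
        have := Nat.left_le_pair A.enc B.enc
        omega
      have hB : B.enc < f := by
        have := Nat.right_le_pair A.enc B.enc
        omega
      simp only [Fml.dec, h0, h1]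
      rw [hp, Nat.unpair_pair, ihA f hA, ihB f hB]
      simp
  | all A ihA =>
    intro fuel h
    match fuel with
    | f + 1 =>
      simp only [Fml.enc] at h ⊢
      have h0 : (6 * A.enc + 4) % 6 = 4 := by omega
      have h1 : (6 * A.enc + 4) / 6 = A.enc := by omega
      have hA : A.enc < f := by omega
      simp [Fml.dec, h0, h1, ihA f hA]
  | ex A ihA =>
    intro fuel h
    match fuel with
    | f + 1 =>
      simp only [Fml.enc] at h ⊢
      have h0 : (6 * A.enc + 5) % 6 = 5 := by omega
      have h1 : (6 * A.enc + 5) / 6 = A.enc := by omega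
      have hA : A.enc < f := by omega
      simp [Fml.dec, h0, h1, ihA f hA]

instance : Encodable Fml :=
  ⟨Fml.enc, fun n => Fml.dec (n + 1) n, fun A => Fml.dec_enc A _ (Nat.lt_succ_self _)⟩

/-- Gödel number of a sentence. -/
def encF (A : Sentence) : ℕ := Encodable.encode A

/-- Gödel number of a sequent (finite set of sentences). -/
def encS (Γ : Finset Sentence) : ℕ := Encodable.encode Γ

/-- Decode a Gödel number into a sentence (with a default value). -/
def decF (n : ℕ) : Sentence := (Encodable.decode (α := Sentence) n).getD ⟨.eq .zero .zero, rfl⟩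

/-- Decode a Gödel number into a sequent (with a default value). -/
def decS (n : ℕ) : Finset Sentence := (Encodable.decode (α := Finset Sentence) n).getD ∅

/-! ### Tupling of natural numbers, with projections -/

/-- Code of a finite sequence (tuple) of natural numbers; codes are nonzero. -/
def tup (l : List ℕ) : ℕ := Encodable.encode l + 1

/-- The finite sequence coded by a natural number. -/
def untup (a : ℕ) : List ℕ := Denumerable.ofNat (List ℕ) (a - 1)

/-- The `i`-th projection `(a)_i`. -/
def proj (a i : ℕ) : ℕ := (untup a).getD i 0

/-- `a` codes a finite sequence (every nonzero number does, bijectively). -/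
def InSeq (a : ℕ) : Prop := a ≠ 0

/-- The code of the empty sequence `⟨⟩` (the root). -/
def rootSeq : ℕ := tup []

/-- The code of `σ⌢i`. -/
def snoc (σ i : ℕ) : ℕ := tup (untup σ ++ [i])

/-! ### Names for the inference rules -/

def axC : ℕ := 1
def andC : ℕ := 2
def orC : ℕ := 3
def omC : ℕ := 4
def exC : ℕ := 5
def cutC : ℕ := 6
def omrepC : ℕ := 7

/-- The end sequent of a (code of a) proof or proof node: `(a)_1` if the rule
`(a)_0` carries no main formula, and `(a)_1 ∪ {(a)_2}` otherwise. -/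
def EndS (a : ℕ) : Finset Sentence :=
  if proj a 0 = cutC ∨ proj a 0 = axC ∨ proj a 0 = omrepC then decS (proj a 1)
  else decS (proj a 1) ∪ {decF (proj a 2)}

/-! ### Local codes of ω-proofs -/

/-- Local codes of `ω`-proofs, in Tait style.  The three `Bool` parameters
respectively allow the cut rule, restrict the `ω`-rule to indices of primitive
recursive functions, and allow the vacuous `ω`-repetition rule. -/
inductive CGen (c p r : Bool) : ℕ → Prop
  | ax (Γ : Finset Sentence) (h : IsAxiom Γ) : CGen c p r (tup [axC, encS Γ])
  | and {a b : ℕ} (Γ : Finset Sentence) (A B : Sentence)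
      (ha : CGen c p r a) (hb : CGen c p r b)
      (ea : EndS a = Γ ∪ {A}) (eb : EndS b = Γ ∪ {B}) :
      CGen c p r (tup [andC, encS Γ, encF (sAnd A B), a, b])
  | or {a : ℕ} (Γ : Finset Sentence) (A B : Sentence) (ha : CGen c p r a)
      (ea : EndS a = Γ ∪ {A, B}) :
      CGen c p r (tup [orC, encS Γ, encF (sOr A B), a])
  | om {e : ℕ} (Γ : Finset Sentence) (A : Fml) (hA : A.cu 1 = true)
      (hp : p = true → PrimIndex e)
      (htot : ∀ n, (peval e n).Dom)
      (hmem : ∀ n, CGen c p r ((peval e n).get (htot n)))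
      (hend : ∀ n, EndS ((peval e n).get (htot n)) = Γ ∪ {sInst A hA n}) :
      CGen c p r (tup [omC, encS Γ, encF (sAll A hA), e])
  | ex {a : ℕ} (Γ : Finset Sentence) (A : Fml) (hA : A.cu 1 = true) (n : ℕ)
      (ha : CGen c p r a) (ea : EndS a = Γ ∪ {sInst A hA n}) :
      CGen c p r (tup [exC, encS Γ, encF (sEx A hA), a])
  | cut {a b : ℕ} (hc : c = true) (Γ : Finset Sentence) (C : Sentence)
      (ha : CGen c p r a) (hb : CGen c p r b)
      (ea : EndS a = Γ ∪ {C}) (eb : EndS b = Γ ∪ {sNeg C}) :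
      CGen c p r (tup [cutC, encS Γ, encF C, a, b])
  | omrep {e : ℕ} (hr : r = true) (Γ : Finset Sentence) (hp : PrimIndex e)
      (htot : ∀ n, (peval e n).Dom)
      (hmem : ∀ n, CGen c p r ((peval e n).get (htot n)))
      (hend : ∀ n, EndS ((peval e n).get (htot n)) = Γ) :
      CGen c p r (tup [omrepC, encS Γ, e])

/-- `C_rec`: recursive local codes of `ω`-proofs. -/
def Crec : ℕ → Prop := CGen true false false

/-- `C_rec^-`: the cut free fragment of `C_rec`. -/
def CrecM : ℕ → Prop := CGen false false false

/-- `C_prec`: primitive recursive local codes of `ω`-proofs. -/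
def Cprec : ℕ → Prop := CGen true true false

/-- `C_prec^-`: the cut free fragment of `C_prec`. -/
def CprecM : ℕ → Prop := CGen false true false

/-- `C_prec^{ω-rep}`: `C_prec` with the vacuous `ω`-repetition rule. -/
def CprecRep : ℕ → Prop := CGen true true true

/-! ### ω-proofs as well founded trees of sequents -/

/-- `σ` is a node of the tree `T_π = {σ ∈ Seq : π(σ) ∈ Seq}`. -/
def TreeOf (π : ℕ → ℕ) (σ : ℕ) : Prop := σ ≠ 0 ∧ π σ ≠ 0

/-- The tree `T_π` is well founded: it has no infinite branch. -/
def WFTree (π : ℕ → ℕ) : Prop :=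
  ¬ ∃ f : ℕ → ℕ, ∀ n : ℕ, TreeOf π (tup ((List.range n).map f))

/-- The inference at an inner node of an `ω`-proof is a correct instance of one
of the rules of Tait-style `ω`-arithmetic. -/
def CorrectInner (π : ℕ → ℕ) (σ : ℕ) : Prop :=
  (∃ (Γ : Finset Sentence) (A B : Sentence),
    π σ = tup [andC, encS Γ, encF (sAnd A B)] ∧
    TreeOf π (snoc σ 0) ∧ TreeOf π (snoc σ 1) ∧ ¬ TreeOf π (snoc σ 2) ∧
    EndS (π (snoc σ 0)) = Γ ∪ {A} ∧ EndS (π (snoc σ 1)) = Γ ∪ {B}) ∨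
  (∃ (Γ : Finset Sentence) (A B : Sentence),
    π σ = tup [orC, encS Γ, encF (sOr A B)] ∧
    TreeOf π (snoc σ 0) ∧ ¬ TreeOf π (snoc σ 1) ∧
    EndS (π (snoc σ 0)) = Γ ∪ {A, B}) ∨
  (∃ (Γ : Finset Sentence) (A : Fml) (hA : A.cu 1 = true),
    π σ = tup [omC, encS Γ, encF (sAll A hA)] ∧
    (∀ n : ℕ, TreeOf π (snoc σ n)) ∧
    (∀ n : ℕ, EndS (π (snoc σ n)) = Γ ∪ {sInst A hA n})) ∨
  (∃ (Γ : Finset Sentence) (A : Fml) (hA : A.cu 1 = true) (n : ℕ),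
    π σ = tup [exC, encS Γ, encF (sEx A hA)] ∧
    TreeOf π (snoc σ 0) ∧ ¬ TreeOf π (snoc σ 1) ∧
    EndS (π (snoc σ 0)) = Γ ∪ {sInst A hA n}) ∨
  (∃ (Γ : Finset Sentence) (C : Sentence),
    π σ = tup [cutC, encS Γ, encF C] ∧
    TreeOf π (snoc σ 0) ∧ TreeOf π (snoc σ 1) ∧ ¬ TreeOf π (snoc σ 2) ∧
    EndS (π (snoc σ 0)) = Γ ∪ {C} ∧ EndS (π (snoc σ 1)) = Γ ∪ {sNeg C})

/-- Local correctness of a function `π : ℕ → ℕ` viewed as a tree of sequents: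
all conditions in the definition of `ω`-proof except well-foundedness. -/
structure LocallyCorrect (π : ℕ → ℕ) : Prop where
  /-- values outside `Seq` are `0` -/
  nonseq : ∀ σ, ¬ InSeq (π σ) → π σ = 0
  /-- `T_π` is closed under initial segments -/
  downward : ∀ σ τ, TreeOf π σ → τ ≠ 0 → untup τ <+: untup σ → TreeOf π τ
  /-- children come first -/
  mono : ∀ σ i j, i < j → TreeOf π (snoc σ j) → TreeOf π (snoc σ i)
  /-- top nodes are axioms -/
  top : ∀ σ, TreeOf π σ → ¬ TreeOf π (snoc σ 0) →
    ∃ Γ : Finset Sentence, IsAxiom Γ ∧ π σ = tup [axC, encS Γ]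
  /-- inner nodes are correct inferences -/
  inner : ∀ σ, TreeOf π σ → TreeOf π (snoc σ 0) → CorrectInner π σ

/-- `π : ℕ → ℕ` is an `ω`-proof. -/
structure IsOmegaProof (π : ℕ → ℕ) extends LocallyCorrect π : Prop where
  /-- the tree `T_π` is well founded -/
  wf : WFTree π

/-- An `ω`-proof is cut free if no node is labelled `cut`. -/
def CutFree (π : ℕ → ℕ) : Prop := ∀ σ, TreeOf π σ → proj (π σ) 0 ≠ cutC

/-! ### The ω-proof `π(a)` coded by a local code `a` -/

open Classical in
/-- The code of the subproof at child `n` of the proof coded by `a`. -/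
noncomputable def childCode (a n : ℕ) : ℕ :=
  if proj a 0 = omC then
    (if h : (peval (proj a 3) n).Dom then (peval (proj a 3) n).get h else 0)
  else if proj a 0 = andC ∨ proj a 0 = orC ∨ proj a 0 = exC ∨ proj a 0 = cutC then
    proj a (n + 3)
  else 0

/-- Walk down a local code along a path. -/
noncomputable def walkCode (a : ℕ) : List ℕ → ℕ
  | [] => a
  | i :: l => walkCode (childCode a i) l

/-- The node label `⟨R,Γ,A⟩` (or `⟨Ax,Γ⟩`) determined by a local code. -/
def nodeVal (b : ℕ) : ℕ :=
  if proj b 0 = axC then tup [axC, proj b 1]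
  else if proj b 0 = andC ∨ proj b 0 = orC ∨ proj b 0 = omC ∨ proj b 0 = exC ∨ proj b 0 = cutC then
    tup [proj b 0, proj b 1, proj b 2]
  else 0

/-- The `ω`-proof `π(a)` determined by a local code `a` (with value `0` at all
other arguments). -/
noncomputable def piOf (a : ℕ) (σ : ℕ) : ℕ :=
  if σ = 0 then 0 else nodeVal (walkCode a (untup σ))

/-! ### Indices (global codes) of recursive and primitive recursive ω-proofs -/

/-- `I_rec`: `a` is an index of a recursive `ω`-proof. -/
def Irec (a : ℕ) : Prop :=
  ∃ h : ∀ n, (peval a n).Dom, IsOmegaProof (fun n => (peval a n).get (h n))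

/-- `I_prec`: `a` is an index of a primitive recursive `ω`-proof. -/
def Iprec (a : ℕ) : Prop :=
  ∃ f : ℕ → ℕ, Nat.Primrec f ∧ (∀ n, peval a n = Part.some (f n)) ∧ IsOmegaProof f

/-- `I_prec^-`: `a` is an index of a primitive recursive cut free `ω`-proof. -/
def IprecM (a : ℕ) : Prop :=
  ∃ f : ℕ → ℕ, Nat.Primrec f ∧ (∀ n, peval a n = Part.some (f n)) ∧
    IsOmegaProof f ∧ CutFree f

/-! ### Ordinal lengths -/

open Classical in
/-- `x + 1` if `P` holds, and `0` otherwise. -/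
noncomputable def succIf (P : Prop) (x : Ordinal.{0}) : Ordinal.{0} :=
  if P then x + 1 else 0

/-- The ordinal rank of a node of the tree `T_π`:
`rank σ = sup {rank (σ⌢i) + 1 : σ⌢i ∈ T_π}`. -/
inductive NodeRank (π : ℕ → ℕ) : ℕ → Ordinal.{0} → Prop
  | mk (σ : ℕ) (o : ℕ → Ordinal.{0})
      (h : ∀ i, TreeOf π (snoc σ i) → NodeRank π (snoc σ i) (o i)) :
      NodeRank π σ (⨆ i, succIf (TreeOf π (snoc σ i)) (o i))

/-- The ordinal length of a local code:  `|⟨Ax,Γ⟩| = 0`,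
`|⟨R,Γ,A,a₁,…,a_k⟩| = sup{|a₁|,…,|a_k|} + 1`, and
`|⟨ω,Γ,∀xA(x),e⟩| = sup{|⟨e⟩(n)| + 1 : n ∈ ℕ}`. -/
inductive CLen : ℕ → Ordinal.{0} → Prop
  | ax (g : ℕ) : CLen (tup [axC, g]) 0
  | one (R g x a : ℕ) (o : Ordinal.{0}) (hR : R = orC ∨ R = exC) (h : CLen a o) :
      CLen (tup [R, g, x, a]) (o + 1)
  | two (R g x a b : ℕ) (oa ob : Ordinal.{0}) (hR : R = andC ∨ R = cutC)
      (ha : CLen a oa) (hb : CLen b ob) :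
      CLen (tup [R, g, x, a, b]) ((oa ⊔ ob) + 1)
  | om (g x e : ℕ) (h : ∀ n, (peval e n).Dom) (o : ℕ → Ordinal.{0})
      (ho : ∀ n, CLen ((peval e n).get (h n)) (o n)) :
      CLen (tup [omC, g, x, e]) (⨆ n, o n + 1)

/-- The ordinal `|a|` of a notation `a ∈ O`:  `|1| = 0`, `|2^a| = |a| + 1`,
`|3·5^e| = sup{|⟨e⟩(n)| : n ∈ ℕ}`. -/
inductive KOrd : ℕ → Ordinal.{0} → Prop
  | one : KOrd 1 0
  | step {a : ℕ} {o : Ordinal.{0}} : KOrd a o → KOrd (2 ^ a) (o + 1)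
  | lim {e : ℕ} (h : ∀ n, (peval e n).Dom) (o : ℕ → Ordinal.{0})
      (ho : ∀ n, KOrd ((peval e n).get (h n)) (o n)) :
      KOrd (3 * 5 ^ e) (⨆ n, o n)


open Classical in
/-- One step of the sequence `a(f)` determined by a local code. -/
noncomputable def branchStep (b k : ℕ) : Option ℕ :=
  if (∃ (Γ : Finset Sentence) (A B : Sentence) (b₀ b₁ : ℕ),
        b = tup [andC, encS Γ, encF (sAnd A B), b₀, b₁]) ∨
     (∃ (Γ : Finset Sentence) (C : Sentence) (b₀ b₁ : ℕ),
        b = tup [cutC, encS Γ, encF C, b₀, b₁]) then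
    some (proj b (3 + k % 2))
  else if ∃ (Γ : Finset Sentence) (A B : Sentence) (c : ℕ),
      b = tup [orC, encS Γ, encF (sOr A B), c] then
    some (proj b 3)
  else if ∃ (Γ : Finset Sentence) (A : Fml) (hA : A.cu 1 = true) (e : ℕ),
      b = tup [omC, encS Γ, encF (sAll A hA), e] then
    (if h : (peval (proj b 3) k).Dom then some ((peval (proj b 3) k).get h) else none)
  else none

/-- The sequence `a(f) = ⟨a₀,a₁,…⟩`:  `chain a f i = some aᵢ` if the `i`-th
element of the sequence is defined, and `none` otherwise. -/
noncomputable def chain (a : ℕ) (f : ℕ → ℕ) : ℕ → Option ℕ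
  | 0 => some a
  | i + 1 =>
    match chain a f i with
    | none => none
    | some b => branchStep b (f i)

section Completeness

open Encodable
open Nat.Partrec (Code)

/-! ### Codes of tuples and sequents -/

theorem untup_tup (l : List ℕ) : untup (tup l) = l := by simp [untup, tup]

theorem tup_ne_zero (l : List ℕ) : tup l ≠ 0 := Nat.succ_ne_zero _

theorem proj_tup (l : List ℕ) (i : ℕ) : proj (tup l) i = l.getD i 0 := by rw [proj, untup_tup]

theorem proj_zero (i : ℕ) : proj 0 i = 0 := by simp [proj, untup]

theorem decS_encS (Γ : Finset Sentence) : decS (encS Γ) = Γ := by simp [decS, encS]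

theorem decF_encF (A : Sentence) : decF (encF A) = A := by simp [decF, encF]

theorem EndS_ax (Γ : Finset Sentence) : EndS (tup [axC, encS Γ]) = Γ := by
  simp [EndS, proj_tup, decS_encS]

/-- End sequent of a tuple labelled by a rule that has a main formula. -/
theorem EndS_main {R : ℕ} (hR : R = andC ∨ R = orC ∨ R = omC ∨ R = exC) (Γ : Finset Sentence)
    (A : Sentence) (l : List ℕ) : EndS (tup (R :: encS Γ :: encF A :: l)) = Γ ∪ {A} := by
  rcases hR with rfl | rfl | rfl | rfl <;>
    simp [EndS, proj_tup, decS_encS, decF_encF, cutC, axC, omrepC, andC, orC, omC, exC]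

/-- The strictly increasing list with the same members as `l`. -/
def sortDedup (l : List ℕ) : List ℕ := (List.range (l.sum + 1)).filter (fun m => ∃ x ∈ l, x = m)

theorem mem_sortDedup {l : List ℕ} {m : ℕ} : m ∈ sortDedup l ↔ m ∈ l := by
  have := fun h : m ∈ l => List.le_sum_of_mem h
  simp only [sortDedup, List.mem_filter, List.mem_range, decide_eq_true_eq, exists_eq_right]
  constructor
  · exact fun h => h.2
  · exact fun h => ⟨Nat.lt_succ_of_le (this h), h⟩

theorem pairwise_sortDedup (l : List ℕ) : (sortDedup l).Pairwise (· < ·) :=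
  List.Pairwise.filter _ List.pairwise_lt_range

theorem primrec_sortDedup : Primrec sortDedup := by
  have hsum : Primrec (fun l : List ℕ => l.sum) :=
    (Primrec.list_foldr Primrec.id (Primrec.const 0)
      (Primrec.nat_add.comp (Primrec.fst.comp Primrec.snd) (Primrec.snd.comp Primrec.snd)).to₂).of_eq
      fun l => by simp [List.sum]
  have hmem : PrimrecRel fun (m : ℕ) (l : List ℕ) => ∃ x ∈ l, x = m := 
    (PrimrecRel.exists_mem_list (R := fun a b : ℕ => a = b) Primrec.eq).comp Primrec.snd Primrec.fst
  exact (PrimrecRel.listFilter hmem).comp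
    (Primrec.list_range.comp (Primrec.succ.comp hsum)) Primrec.id

theorem encode_list_eq_encode_map {α : Type*} [Encodable α] (l : List α) :
    encode l = encode (l.map encode) := by
  induction l with
  | nil => rfl
  | cons a l ih => simp [ih]

theorem exists_sorted_of_eq_encode_sort {α : Type*} [Encodable α] {s : Multiset α} {n : ℕ}
    {r : α → α → Prop} {_ : DecidableRel r} {_ : IsTrans α r} {_ : Std.Antisymm r}
    {_ : Std.Total r} (hn : n = encode (s.sort r)) (hr : ∀ a b, r a b → encode a ≤ encode b) :
    ∃ l : List α, n = encode l ∧ l.Pairwise (fun a b => encode a ≤ encode b) ∧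
      (l : Multiset α) = s :=
  ⟨s.sort r, hn, (Multiset.pairwise_sort s r).imp (hr _ _), Multiset.sort_eq s r⟩

theorem exists_encS_eq (Γ : Finset Sentence) : ∃ l : List Sentence, encS Γ = encode l ∧
    l.Pairwise (fun a b => encode a ≤ encode b) ∧ (l : Multiset Sentence) = Γ.val :=
  exists_sorted_of_eq_encode_sort rfl fun _ _ h => h

theorem encS_toFinset (l : List Sentence) :
    encS l.toFinset = encode (sortDedup (l.map encF)) := by
  obtain ⟨s, hs, hsort, hval⟩ := exists_encS_eq l.toFinset
  have hnd : s.Nodup := by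
    have := l.toFinset.nodup
    rw [← hval] at this
    exact Multiset.coe_nodup.1 this
  have hmem : ∀ a, a ∈ s ↔ a ∈ l := fun a => by
    rw [← Multiset.mem_coe, hval, Finset.mem_val, List.mem_toFinset]
  rw [hs, encode_list_eq_encode_map]
  congr 1
  have hperm : (s.map encode).Perm (sortDedup (l.map encF)) := by
    rw [List.perm_ext_iff_of_nodup (hnd.map encode_injective)
      ((pairwise_sortDedup _).imp Nat.ne_of_lt)]
    intro m
    simp only [mem_sortDedup, List.mem_map, hmem]
    rfl
  exact hperm.eq_of_pairwise (fun a b _ _ => le_antisymm)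
    (List.pairwise_map.2 hsort) ((pairwise_sortDedup _).imp le_of_lt)

/-! ### Closing formulas by numerals -/

/-- Replace every variable `i ≥ d` by the numeral of `ρ (i - d)`. -/
def Trm.close (ρ : ℕ → ℕ) (d : ℕ) : Trm → Trm
  | .var i => if i < d then .var i else numeral (ρ (i - d))
  | .zero => .zero
  | .one => .one
  | .add s t => .add (s.close ρ d) (t.close ρ d)
  | .mul s t => .mul (s.close ρ d) (t.close ρ d)

/-- Replace every free variable `i ≥ d` by the numeral of `ρ (i - d)`. -/
def Fml.close (ρ : ℕ → ℕ) : ℕ → Fml → Fml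
  | d, .eq s t => .eq (s.close ρ d) (t.close ρ d)
  | d, .ne s t => .ne (s.close ρ d) (t.close ρ d)
  | d, .and A B => .and (A.close ρ d) (B.close ρ d)
  | d, .or A B => .or (A.close ρ d) (B.close ρ d)
  | d, .all A => .all (A.close ρ (d + 1))
  | d, .ex A => .ex (A.close ρ (d + 1))

theorem Trm.cu_close (ρ : ℕ → ℕ) (d : ℕ) (t : Trm) : (t.close ρ d).cu d = true := by
  induction t with
  | var i =>
    by_cases h : i < d
    · simp [Trm.close, h, Trm.cu]
    · simp only [Trm.close, h, if_false]
      exact Trm.cu_mono _ (Nat.zero_le d) (numeral_cu _)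
  | _ => simp_all [Trm.close, Trm.cu]

theorem Fml.cu_close (ρ : ℕ → ℕ) (A : Fml) : ∀ d, (A.close ρ d).cu d = true := by
  induction A <;> simp_all [Fml.close, Fml.cu, Trm.cu_close]

theorem Trm.close_of_cu (ρ : ℕ → ℕ) {d : ℕ} {t : Trm} (h : t.cu d = true) : t.close ρ d = t := by
  induction t <;> simp_all [Trm.close, Trm.cu]

theorem Fml.close_of_cu (ρ : ℕ → ℕ) (A : Fml) : ∀ {d}, A.cu d = true → A.close ρ d = A := by
  induction A <;> simp_all [Fml.close, Fml.cu, Trm.close_of_cu]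

theorem Trm.sub_of_cu {t s : Trm} {k : ℕ} (h : s.cu k = true) : Trm.sub t k s = s := by
  induction s with
  | var i =>
    simp only [Trm.cu, decide_eq_true_eq] at h
    simp [Trm.sub, h.ne, h.le.not_gt]
  | _ => simp_all [Trm.sub, Trm.cu]

theorem Trm.sub_close (ρ : ℕ → ℕ) (n d : ℕ) (t : Trm) :
    Trm.sub (numeral n) d (t.close ρ (d + 1)) = t.close (consEnv n ρ) d := by
  induction t with
  | var i =>
    rcases lt_trichotomy i d with h | rfl | h
    · simp [Trm.close, h, Nat.lt_succ_of_lt h, Trm.sub, h.ne, h.le.not_gt]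
    · simp [Trm.close, Trm.sub, consEnv]
    · obtain ⟨j, rfl⟩ : ∃ j, i = d + (j + 1) := ⟨i - d - 1, by omega⟩
      have h1 : ¬ d + (j + 1) < d + 1 := by omega
      have h2 : d + (j + 1) - (d + 1) = j := by omega
      simp only [Trm.close, h1, if_false, h2, h.le.not_gt, Nat.add_sub_cancel_left, consEnv]
      exact Trm.sub_of_cu (Trm.cu_mono _ (Nat.zero_le _) (numeral_cu _))
  | _ => simp_all [Trm.close, Trm.sub]

theorem Fml.sub_close (ρ : ℕ → ℕ) (n : ℕ) (A : Fml) :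
    ∀ d, (A.close ρ (d + 1)).sub (numeral n) d = A.close (consEnv n ρ) d := by
  induction A <;> simp_all [Fml.close, Fml.sub, Trm.sub_close]

theorem val_numeral (τ : ℕ → ℕ) (n : ℕ) : (numeral n).val τ = n := by
  induction n <;> simp_all [numeral, Trm.val]

theorem Trm.val_close (ρ τ : ℕ → ℕ) (d : ℕ) (t : Trm) :
    (t.close ρ d).val τ = t.val (fun i => if i < d then τ i else ρ (i - d)) := by
  induction t with
  | var i =>
    by_cases h : i < d <;> simp [Trm.close, h, Trm.val, val_numeral]
  | _ => simp_all [Trm.close, Trm.val]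

theorem consEnv_ite (n d : ℕ) (ρ τ : ℕ → ℕ) :
    (fun i => if i < d + 1 then consEnv n τ i else ρ (i - (d + 1))) =
      consEnv n (fun i => if i < d then τ i else ρ (i - d)) := by
  funext i
  cases i <;> simp [consEnv]

theorem Fml.sat_close (ρ : ℕ → ℕ) (A : Fml) : ∀ (τ : ℕ → ℕ) (d : ℕ),
    (A.close ρ d).Sat τ ↔ A.Sat (fun i => if i < d then τ i else ρ (i - d)) := by
  induction A <;>
    simp_all only [Fml.close, Fml.Sat, Trm.val_close, consEnv_ite, implies_true]

theorem Fml.sat_close_zero (ρ τ : ℕ → ℕ) (A : Fml) : (A.close ρ 0).Sat τ ↔ A.Sat ρ := by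
  simp [Fml.sat_close]

/-- The sentence obtained from `A` by replacing free variables with the numerals of `ρ`. -/
def closeS (ρ : ℕ → ℕ) (A : Fml) : Sentence := ⟨A.close ρ 0, Fml.cu_close ρ A 0⟩

theorem sentTrue_closeS (ρ : ℕ → ℕ) (A : Fml) : sentTrue (closeS ρ A) ↔ A.Sat ρ :=
  Fml.sat_close_zero _ _ _

theorem sInst_close (ρ : ℕ → ℕ) (A : Fml) (n : ℕ) :
    sInst (A.close ρ 1) (Fml.cu_close ρ A 1) n = closeS (consEnv n ρ) A :=
  Subtype.ext (Fml.sub_close ρ n A 0)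

theorem sentTrue_sInst (A : Fml) (hA : A.cu 1 = true) (n : ℕ) :
    sentTrue (sInst A hA n) ↔ A.Sat (consEnv n fun _ => 0) := by
  have h : sInst A hA n = closeS (consEnv n fun _ => 0) A := Subtype.ext (by
    change A.sub (numeral n) 0 = A.close _ 0
    rw [← Fml.sub_close, Fml.close_of_cu _ A hA])
  rw [h, sentTrue_closeS]

theorem closeS_val (ρ : ℕ → ℕ) (A : Sentence) : closeS ρ A.1 = A :=
  Subtype.ext (Fml.close_of_cu ρ A.1 A.2)

/-! ### Soundness -/

theorem seqTrue_of_cprecM {a : ℕ} (h : CprecM a) : SeqTrue (EndS a) := by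
  have union : ∀ (Γ : Finset Sentence) (A : Sentence),
      SeqTrue (Γ ∪ {A}) ↔ SeqTrue Γ ∨ sentTrue A := fun Γ A => by
    simp [SeqTrue, or_and_right, exists_or, or_comm]
  induction h with
  | ax Γ h =>
    obtain ⟨A, hA, -, ht⟩ := h
    rw [EndS_ax]
    exact ⟨A, hA, ht⟩
  | and Γ A B _ _ ea eb iha ihb =>
    rw [ea, union] at iha
    rw [eb, union] at ihb
    rw [EndS_main (by simp), union]
    exact iha.elim Or.inl fun hA => ihb.imp_right fun hB => ⟨hA, hB⟩
  | or Γ A B _ ea ih =>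
    have hins : ({A, B} : Finset Sentence) = {A} ∪ {B} := rfl
    rw [ea, hins, ← Finset.union_assoc, union, union, or_assoc] at ih
    rw [EndS_main (by simp), union]
    exact ih
  | om Γ A hA hp htot hmem hend ih =>
    rw [EndS_main (by simp), union]
    by_cases hΓ : SeqTrue Γ
    · exact Or.inl hΓ
    · refine Or.inr fun n => (sentTrue_sInst A hA n).1 ?_
      have := ih n
      rw [hend, union] at this
      exact this.resolve_left hΓ
  | ex Γ A hA n _ ea ih =>
    rw [ea, union, sentTrue_sInst] at ih
    rw [EndS_main (by simp), union]
    exact ih.imp_right fun h => ⟨n, h⟩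
  | cut hc => cases hc
  | omrep hr => cases hr

/-! ### The `ω`-proof determined by a local code -/

theorem childCode_zero (i : ℕ) : childCode 0 i = 0 := by
  simp [childCode, proj_zero, omC, andC, orC, exC, cutC]

theorem walkCode_zero (l : List ℕ) : walkCode 0 l = 0 := by
  induction l with
  | nil => rfl
  | cons i l ih => rw [walkCode, childCode_zero, ih]

theorem nodeVal_zero : nodeVal 0 = 0 := by
  simp [nodeVal, proj_zero, omC, andC, orC, exC, cutC, axC]

theorem walkCode_append (a : ℕ) (l m : List ℕ) :
    walkCode a (l ++ m) = walkCode (walkCode a l) m := by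
  induction l generalizing a with
  | nil => rfl
  | cons i l ih => exact ih _

theorem childCode_ax (g i : ℕ) : childCode (tup [axC, g]) i = 0 := by
  simp [childCode, proj_tup, omC, andC, orC, exC, cutC, axC]

theorem childCode_om {g x e n y : ℕ} (h : peval e n = Part.some y) :
    childCode (tup [omC, g, x, e]) n = y := by
  simp [childCode, proj_tup, h]

theorem childCode_finite {R : ℕ} (hR : R = andC ∨ R = orC ∨ R = exC) (g x i : ℕ) (l : List ℕ) :
    childCode (tup (R :: g :: x :: l)) i = l.getD i 0 := by
  rcases hR with rfl | rfl | rfl <;>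
    simp [childCode, proj_tup, omC, andC, orC, exC, cutC]

theorem nodeVal_ax (g : ℕ) : nodeVal (tup [axC, g]) = tup [axC, g] := by
  simp [nodeVal, proj_tup]

theorem nodeVal_main {R : ℕ} (hR : R = andC ∨ R = orC ∨ R = omC ∨ R = exC) (g x : ℕ)
    (l : List ℕ) : nodeVal (tup (R :: g :: x :: l)) = tup [R, g, x] := by
  rcases hR with rfl | rfl | rfl | rfl <;>
    simp [nodeVal, proj_tup, omC, andC, orC, exC, cutC, axC]

/-- The possible shapes of a code in `C_prec^-`, in terms of its children. -/
inductive Shape (b : ℕ) : Prop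
  | ax (Γ : Finset Sentence) (h : IsAxiom Γ) (hv : nodeVal b = tup [axC, encS Γ])
      (hc : ∀ i, childCode b i = 0)
  | and (Γ : Finset Sentence) (A B : Sentence)
      (hv : nodeVal b = tup [andC, encS Γ, encF (sAnd A B)])
      (h0 : CprecM (childCode b 0)) (h1 : CprecM (childCode b 1))
      (hc : ∀ i, childCode b (i + 2) = 0)
      (e0 : EndS (childCode b 0) = Γ ∪ {A}) (e1 : EndS (childCode b 1) = Γ ∪ {B})
  | or (Γ : Finset Sentence) (A B : Sentence)
      (hv : nodeVal b = tup [orC, encS Γ, encF (sOr A B)])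
      (h0 : CprecM (childCode b 0)) (hc : ∀ i, childCode b (i + 1) = 0)
      (e0 : EndS (childCode b 0) = Γ ∪ {A, B})
  | om (Γ : Finset Sentence) (A : Fml) (hA : A.cu 1 = true)
      (hv : nodeVal b = tup [omC, encS Γ, encF (sAll A hA)])
      (hc : ∀ i, CprecM (childCode b i)) (e : ∀ i, EndS (childCode b i) = Γ ∪ {sInst A hA i})
  | ex (Γ : Finset Sentence) (A : Fml) (hA : A.cu 1 = true) (n : ℕ)
      (hv : nodeVal b = tup [exC, encS Γ, encF (sEx A hA)])
      (h0 : CprecM (childCode b 0)) (hc : ∀ i, childCode b (i + 1) = 0)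
      (e0 : EndS (childCode b 0) = Γ ∪ {sInst A hA n})

theorem CprecM.shape {b : ℕ} (h : CprecM b) : Shape b := by
  cases h with
  | ax Γ h => exact .ax Γ h (nodeVal_ax _) (childCode_ax _)
  | and Γ A B ha hb ea eb =>
    have hc := childCode_finite (R := andC) (by simp) (encS Γ) (encF (sAnd A B))
    refine .and Γ A B (nodeVal_main (by simp) ..) ?_ ?_ ?_ ?_ ?_ <;>
      first | exact fun i => hc _ _ | (rw [hc]; assumption)
  | or Γ A B ha ea =>
    have hc := childCode_finite (R := orC) (by simp) (encS Γ) (encF (sOr A B))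
    refine .or Γ A B (nodeVal_main (by simp) ..) ?_ ?_ ?_ <;>
      first | exact fun i => hc _ _ | (rw [hc]; assumption)
  | @om e Γ A hA hp htot hmem hend =>
    have hc : ∀ i, childCode (tup [omC, encS Γ, encF (sAll A hA), e]) i =
        (peval e i).get (htot i) := fun i => childCode_om (Part.some_get (htot i)).symm
    refine .om Γ A hA (nodeVal_main (by simp) ..) ?_ ?_ <;> intro i <;> rw [hc]
    exacts [hmem i, hend i]
  | ex Γ A hA n ha ea =>
    have hc := childCode_finite (R := exC) (by simp) (encS Γ) (encF (sEx A hA))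
    refine .ex Γ A hA n (nodeVal_main (by simp) ..) ?_ ?_ ?_ <;>
      first | exact fun i => hc _ _ | (rw [hc]; assumption)
  | cut hc => cases hc
  | omrep hr => cases hr

theorem CprecM.nodeVal_ne_zero {b : ℕ} (h : CprecM b) : nodeVal b ≠ 0 := by
  cases h.shape with
  | _ => simp [*, tup_ne_zero]

theorem CprecM.ne_zero {b : ℕ} (h : CprecM b) : b ≠ 0 := fun hb =>
  h.nodeVal_ne_zero (hb ▸ nodeVal_zero)

theorem CprecM.childCode {b : ℕ} (h : CprecM b) (i : ℕ) :
    CprecM (childCode b i) ∨ Shoen.childCode b i = 0 := by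
  cases h.shape with
  | ax Γ h hv hc => exact Or.inr (hc i)
  | and Γ A B hv h0 h1 hc e0 e1 =>
    match i with
    | 0 => exact Or.inl h0
    | 1 => exact Or.inl h1
    | i + 2 => exact Or.inr (hc i)
  | or Γ A B hv h0 hc e0 =>
    match i with
    | 0 => exact Or.inl h0
    | i + 1 => exact Or.inr (hc i)
  | om Γ A hA hv hc e => exact Or.inl (hc i)
  | ex Γ A hA n hv h0 hc e0 =>
    match i with
    | 0 => exact Or.inl h0
    | i + 1 => exact Or.inr (hc i)

theorem CprecM.walkCode {a : ℕ} (h : CprecM a) (l : List ℕ) :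
    CprecM (walkCode a l) ∨ Shoen.walkCode a l = 0 := by
  induction l generalizing a with
  | nil => exact Or.inl h
  | cons i l ih =>
    rcases h.childCode i with hc | hc
    · exact ih hc
    · right
      rw [Shoen.walkCode, hc, walkCode_zero]

theorem piOf_eq {a σ : ℕ} (hσ : σ ≠ 0) : piOf a σ = nodeVal (walkCode a (untup σ)) := if_neg hσ

theorem treeOf_piOf {a : ℕ} (h : CprecM a) {σ : ℕ} :
    TreeOf (piOf a) σ ↔ σ ≠ 0 ∧ CprecM (walkCode a (untup σ)) := by
  refine and_congr_right fun hσ => ?_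
  rw [piOf_eq hσ]
  refine ⟨fun hn => (h.walkCode _).resolve_right fun h0 => hn ?_, CprecM.nodeVal_ne_zero⟩
  rw [h0, nodeVal_zero]

theorem snoc_ne_zero (σ i : ℕ) : snoc σ i ≠ 0 := tup_ne_zero _

theorem walkCode_snoc (a σ i : ℕ) :
    walkCode a (untup (snoc σ i)) = childCode (walkCode a (untup σ)) i := by
  rw [snoc, untup_tup, walkCode_append]
  rfl

theorem treeOf_piOf_snoc {a : ℕ} (h : CprecM a) {σ i : ℕ} :
    TreeOf (piOf a) (snoc σ i) ↔ CprecM (childCode (walkCode a (untup σ)) i) := by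
  rw [treeOf_piOf h, walkCode_snoc, and_iff_right (snoc_ne_zero σ i)]

theorem EndS_nodeVal {b : ℕ} (h : CprecM b) : EndS (nodeVal b) = EndS b := by
  cases h with
  | ax Γ h => rw [nodeVal_ax]
  | cut hc => cases hc
  | omrep hr => cases hr
  | _ => rw [nodeVal_main (by simp), EndS_main (by simp), EndS_main (by simp)]

theorem EndS_piOf_snoc {a σ i : ℕ} (h : CprecM (childCode (walkCode a (untup σ)) i)) :
    EndS (piOf a (snoc σ i)) = EndS (childCode (walkCode a (untup σ)) i) := by
  rw [piOf_eq (snoc_ne_zero σ i), walkCode_snoc, EndS_nodeVal h]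

theorem not_cprecM_zero : ¬ CprecM 0 := fun h => h.ne_zero rfl

theorem locallyCorrect_piOf {a : ℕ} (h : CprecM a) : LocallyCorrect (piOf a) where
  nonseq σ hσ := not_not.1 hσ
  downward σ τ hσ hτ hpre := by
    rw [treeOf_piOf h] at hσ ⊢
    obtain ⟨l, hl⟩ := hpre
    refine ⟨hτ, (h.walkCode _).resolve_right fun h0 => hσ.2.ne_zero ?_⟩
    rw [← hl, walkCode_append, h0, walkCode_zero]
  mono σ i j hij hj := by
    rw [treeOf_piOf_snoc h] at hj ⊢
    rcases h.walkCode (untup σ) with hb | hb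
    · cases hb.shape with
      | ax Γ h hv hc => exact absurd (hc j) hj.ne_zero
      | and Γ A B hv h0 h1 hc e0 e1 =>
        match i, j with
        | 0, _ => exact h0
        | 1, _ => exact h1
        | i + 2, j + 2 => exact absurd (hc j) hj.ne_zero
      | or Γ A B hv h0 hc e0 =>
        match i, j with
        | 0, _ => exact h0
        | i + 1, j + 1 => exact absurd (hc j) hj.ne_zero
      | om Γ A hA hv hc e => exact hc i
      | ex Γ A hA n hv h0 hc e0 =>
        match i, j with
        | 0, _ => exact h0
        | i + 1, j + 1 => exact absurd (hc j) hj.ne_zero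
    · rw [hb, childCode_zero] at hj
      exact absurd hj not_cprecM_zero
  top σ hσ h0 := by
    rw [treeOf_piOf_snoc h] at h0
    obtain ⟨hσ0, hb⟩ := (treeOf_piOf h).1 hσ
    rw [piOf_eq hσ0]
    cases hb.shape with
    | ax Γ h hv hc => exact ⟨Γ, h, hv⟩
    | om Γ A hA hv hc e => exact absurd (hc 0) h0
    | _ => contradiction
  inner σ hσ h0 := by
    rw [treeOf_piOf_snoc h] at h0
    obtain ⟨hσ0, hb⟩ := (treeOf_piOf h).1 hσ
    simp only [CorrectInner, treeOf_piOf_snoc h, piOf_eq hσ0]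
    cases hb.shape with
    | ax Γ h hv hc => exact absurd (hc 0) h0.ne_zero
    | and Γ A B hv h0 h1 hc e0 e1 =>
      refine Or.inl ⟨Γ, A, B, hv, h0, h1, fun h2 => h2.ne_zero (hc 0), ?_, ?_⟩
      · rw [EndS_piOf_snoc h0, e0]
      · rw [EndS_piOf_snoc h1, e1]
    | or Γ A B hv h0 hc e0 =>
      refine Or.inr (Or.inl ⟨Γ, A, B, hv, h0, fun h2 => h2.ne_zero (hc 0), ?_⟩)
      rw [EndS_piOf_snoc h0, e0]
    | om Γ A hA hv hc e =>
      refine Or.inr (Or.inr (Or.inl ⟨Γ, A, hA, hv, hc, fun n => ?_⟩))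
      rw [EndS_piOf_snoc (hc n), e]
    | ex Γ A hA n hv h0 hc e0 =>
      refine Or.inr (Or.inr (Or.inr (Or.inl
        ⟨Γ, A, hA, n, hv, h0, fun h2 => h2.ne_zero (hc 0), ?_⟩)))
      rw [EndS_piOf_snoc h0, e0]

theorem exists_walkCode_eq_zero {a : ℕ} (h : CprecM a) :
    ∀ f : ℕ → ℕ, ∃ n, walkCode a ((List.range n).map f) = 0 := by
  have step : ∀ (b : ℕ) (f : ℕ → ℕ),
      (∃ n, walkCode (childCode b (f 0)) ((List.range n).map fun i => f (i + 1)) = 0) →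
        ∃ n, walkCode b ((List.range n).map f) = 0 := by
    rintro b f ⟨n, hn⟩
    refine ⟨n + 1, ?_⟩
    rw [List.range_succ_eq_map, List.map_cons, List.map_map]
    exact hn
  induction h with
  | ax Γ h => exact fun f => step _ f ⟨0, childCode_ax _ _⟩
  | and Γ A B _ _ _ _ iha ihb =>
    intro f
    refine step _ f ?_
    rw [childCode_finite (by simp)]
    match f 0 with
    | 0 => exact iha _
    | 1 => exact ihb _
    | i + 2 => exact ⟨0, rfl⟩
  | or Γ A B _ _ ih =>
    intro f
    refine step _ f ?_
    rw [childCode_finite (by simp)]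
    match f 0 with
    | 0 => exact ih _
    | i + 1 => exact ⟨0, rfl⟩
  | om Γ A hA hp htot hmem hend ih =>
    intro f
    refine step _ f ?_
    rw [childCode_om (Part.some_get (htot (f 0))).symm]
    exact ih _ _
  | ex Γ A hA n _ _ ih =>
    intro f
    refine step _ f ?_
    rw [childCode_finite (by simp)]
    match f 0 with
    | 0 => exact ih _
    | i + 1 => exact ⟨0, rfl⟩
  | cut hc => cases hc
  | omrep hr => cases hr

theorem isOmegaProof_piOf {a : ℕ} (h : CprecM a) : IsOmegaProof (piOf a) where
  toLocallyCorrect := locallyCorrect_piOf h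
  wf := by
    rintro ⟨f, hf⟩
    obtain ⟨n, hn⟩ := exists_walkCode_eq_zero h f
    have := ((treeOf_piOf h).1 (hf n)).2
    rw [untup_tup, hn] at this
    exact not_cprecM_zero this

theorem cutFree_piOf {a : ℕ} (h : CprecM a) : CutFree (piOf a) := by
  intro σ hσ
  obtain ⟨hσ0, hb⟩ := (treeOf_piOf h).1 hσ
  rw [piOf_eq hσ0]
  cases hb.shape with
  | _ => simp [*, proj_tup, omC, andC, orC, exC, cutC, axC]

/-! ### The primitive recursive proof search -/

/-- The environment given by a list, with value `0` beyond its length. -/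
def env (v : List ℕ) (i : ℕ) : ℕ := v.getD i 0

theorem consEnv_env (n : ℕ) (v : List ℕ) : consEnv n (env v) = env (n :: v) := by
  funext i
  cases i <;> rfl

theorem primrec_env (i : ℕ) : Primrec fun v => env v i :=
  (Primrec.list_getD 0).comp Primrec.id (Primrec.const i)

theorem Trm.primrec_val (t : Trm) : Primrec fun v => t.val (env v) := by
  induction t with
  | var i => exact primrec_env i
  | zero => exact Primrec.const 0
  | one => exact Primrec.const 1
  | add s t ihs iht => exact Primrec.nat_add.comp ihs iht
  | mul s t ihs iht => exact Primrec.nat_mul.comp ihs iht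

theorem primrec_mul_add {α : Type*} [Primcodable α] {f : α → ℕ} (hf : Primrec f) (m r : ℕ) :
    Primrec fun a => m * f a + r :=
  Primrec.nat_add.comp (Primrec.nat_mul.comp (Primrec.const m) hf) (Primrec.const r)

theorem primrec_enc_numeral : Primrec fun n => (numeral n).enc :=
  (Primrec.nat_rec₁ 1 (f := fun _ x => 5 * Nat.pair x 2 + 3)
    (primrec_mul_add (Primrec₂.natPair.comp Primrec.snd (Primrec.const 2)) 5 3).to₂).of_eq
    fun n => by
      induction n with
      | zero => rfl
      | succ n ih => simp only [numeral, Trm.enc, ← ih]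

theorem Trm.primrec_enc_close (d : ℕ) (t : Trm) : Primrec fun v => (t.close (env v) d).enc := by
  induction t with
  | var i =>
    by_cases h : i < d
    · simpa only [Trm.close, h, if_true] using Primrec.const _
    · simpa only [Trm.close, h, if_false] using primrec_enc_numeral.comp (primrec_env _)
  | zero => exact Primrec.const 1
  | one => exact Primrec.const 2
  | add s t ihs iht => exact primrec_mul_add (Primrec₂.natPair.comp ihs iht) 5 3
  | mul s t ihs iht => exact primrec_mul_add (Primrec₂.natPair.comp ihs iht) 5 4

theorem Fml.primrec_enc_close (A : Fml) :
    ∀ d, Primrec fun v => (A.close (env v) d).enc := by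
  induction A with
  | eq s t =>
    exact fun d => primrec_mul_add
      (Primrec₂.natPair.comp (s.primrec_enc_close d) (t.primrec_enc_close d)) 6 0
  | ne s t =>
    exact fun d => primrec_mul_add
      (Primrec₂.natPair.comp (s.primrec_enc_close d) (t.primrec_enc_close d)) 6 1
  | and A B ihA ihB => exact fun d => primrec_mul_add (Primrec₂.natPair.comp (ihA d) (ihB d)) 6 2
  | or A B ihA ihB => exact fun d => primrec_mul_add (Primrec₂.natPair.comp (ihA d) (ihB d)) 6 3
  | all A ih => exact fun d => primrec_mul_add (ih (d + 1)) 6 4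
  | ex A ih => exact fun d => primrec_mul_add (ih (d + 1)) 6 5

theorem primrec_encF_closeS (A : Fml) : Primrec fun v => encF (closeS (env v) A) :=
  A.primrec_enc_close 0

/-- The `i`-th formula of a list, with a literal as default value. -/
def fmlAt (S : List Fml) (i : ℕ) : Fml := S.getD i (.eq .zero .zero)

theorem primrec₂_fmlAt {α σ : Type*} [Primcodable α] [Primcodable σ] {H : Fml → α → σ}
    (hH : ∀ C, Primrec (H C)) (S : List Fml) : Primrec₂ fun i a => H (fmlAt S i) a := by
  induction S with
  | nil => exact (hH _).comp Primrec.snd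
  | cons C S ih =>
    refine (Primrec.nat_casesOn Primrec.fst ((hH C).comp Primrec.snd)
      (ih.comp Primrec.snd (Primrec.snd.comp Primrec.fst)).to₂).of_eq fun p => ?_
    rcases p with ⟨_ | i, a⟩ <;> rfl

/-- A closure: the index of a formula in a fixed list, with an environment. -/
abbrev Clo : Type := ℕ × List ℕ

/-- The sentence denoted by a closure. -/
def cloS (S : List Fml) (x : Clo) : Sentence := closeS (env x.2) (fmlAt S x.1)

/-- The sentence `∀x A(x)` for the closure of `A(x)`. -/
def cloAll (S : List Fml) (x : Clo) : Sentence := closeS (env x.2) (.all (fmlAt S x.1))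

theorem primrec_encF_cloS (S : List Fml) : Primrec fun x => encF (cloS S x) :=
  (primrec₂_fmlAt primrec_encF_closeS S).comp Primrec.fst Primrec.snd

theorem primrec_encF_cloAll (S : List Fml) : Primrec fun x => encF (cloAll S x) :=
  (primrec₂_fmlAt (fun C => primrec_encF_closeS (.all C)) S).comp Primrec.fst Primrec.snd

/-- The sequent of the members of `Δ` and of the sentences denoted by the members of `L`. -/
def ctx (S : List Fml) (Δ : List Sentence) (L : List Clo) : Finset Sentence :=
  (Δ ++ L.map (cloS S)).toFinset

theorem primrec_encS_ctx (S : List Fml) (Δ : List Sentence) :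
    Primrec fun L => encS (ctx S Δ L) := by
  have hmap : Primrec fun L : List Clo => L.map fun x => encF (cloS S x) :=
    Primrec.list_map Primrec.id ((primrec_encF_cloS S).comp Primrec.snd).to₂
  refine (Primrec.encode.comp (primrec_sortDedup.comp
    (Primrec.list_append.comp (Primrec.const (Δ.map encF)) hmap))).of_eq fun L => ?_
  rw [ctx, encS_toFinset]
  simp [Function.comp_def]

/-- A state of the search: the closures collected so far, the stage, and the closure of a formula
`A(x)` such that `∀x A(x)` is in the sequent, used to delay the search. -/
abbrev SearchState : Type := List Clo × ℕ × Clo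

/-- The code of a proof of the sequent of a search state, ending with an inference that repeats the
delaying formula `∀x A(x)`; `c` is meant to compute the premises. -/
def delay (S : List Fml) (Δ : List Sentence) (c : Code) (s : SearchState) : ℕ :=
  tup [omC, encS (ctx S Δ s.1), encF (cloAll S s.2.2), encode (c.curry (encode s))]

/-- The inference (read upwards) that the search performs for the closure of a formula under the
environment `v`. -/
def act (S : List Fml) (Δ : List Sentence) (c : Code) (s : SearchState) (v : List ℕ) : Fml → ℕ
  | .eq t u => if t.val (env v) = u.val (env v) then tup [axC, encS (ctx S Δ s.1)]
      else delay S Δ c (s.1, s.2.1 + 1, s.2.2)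
  | .ne t u => if t.val (env v) = u.val (env v) then delay S Δ c (s.1, s.2.1 + 1, s.2.2)
      else tup [axC, encS (ctx S Δ s.1)]
  | .and A B => tup [andC, encS (ctx S Δ s.1), encF (closeS (env v) (.and A B)),
      delay S Δ c (s.1 ++ [(S.idxOf A, v)], s.2.1 + 1, s.2.2),
      delay S Δ c (s.1 ++ [(S.idxOf B, v)], s.2.1 + 1, s.2.2)]
  | .or A B => tup [orC, encS (ctx S Δ s.1), encF (closeS (env v) (.or A B)),
      delay S Δ c (s.1 ++ [(S.idxOf A, v), (S.idxOf B, v)], s.2.1 + 1, s.2.2)]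
  | .all A => delay S Δ c (s.1, s.2.1 + 1, (S.idxOf A, v))
  | .ex A => tup [exC, encS (ctx S Δ s.1), encF (closeS (env v) (.ex A)),
      delay S Δ c (s.1 ++ [(S.idxOf A, s.2.1.unpair.2.unpair.1 :: v)], s.2.1 + 1, s.2.2)]

/-- One step of the search: the stage determines which closure is treated. -/
def searchStep (S : List Fml) (Δ : List Sentence) (c : Code) (s : SearchState) : ℕ :=
  match s.1[s.2.1.unpair.1]? with
  | none => delay S Δ c (s.1, s.2.1 + 1, s.2.2)
  | some x => act S Δ c s x.2 (fmlAt S x.1)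

/-- Add the `n`-th instance of the delaying formula to a search state. -/
def SearchState.inst (s : SearchState) (n : ℕ) : SearchState :=
  (s.1 ++ [(s.2.2.1, n :: s.2.2.2)], s.2)

/-- The function whose sections are to be the premises of the delaying inferences. -/
def searchFun (S : List Fml) (Δ : List Sentence) (c : Code) (x : ℕ) : ℕ :=
  searchStep S Δ c
    (SearchState.inst ((decode (α := SearchState) x.unpair.1).getD ([], 0, 0, [])) x.unpair.2)

section Primrec

variable {α : Type*} [Primcodable α]

theorem primrec_cons {f : α → ℕ} {l : α → List ℕ} (hf : Primrec f) (hl : Primrec l) :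
    Primrec fun a => f a :: l a := Primrec.list_cons.comp hf hl

theorem primrec_tup : Primrec tup := Primrec.succ.comp Primrec.encode

theorem primrec_delay (S : List Fml) (Δ : List Sentence) : Primrec₂ (delay S Δ) := by
  refine primrec_tup.comp (primrec_cons (Primrec.const _) (primrec_cons ?_
    (primrec_cons ?_ (primrec_cons ?_ (Primrec.const [])))))
  · exact (primrec_encS_ctx S Δ).comp (Primrec.fst.comp Primrec.snd)
  · exact (primrec_encF_cloAll S).comp (Primrec.snd.comp (Primrec.snd.comp Primrec.snd))
  · exact Primrec.encode.comp (Code.primrec₂_curry.comp Primrec.fst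
      (Primrec.encode.comp Primrec.snd))

theorem primrec_act (S : List Fml) (Δ : List Sentence) (C : Fml) :
    Primrec fun p : (Code × SearchState) × List ℕ => act S Δ p.1.1 p.1.2 p.2 C := by
  have hc : Primrec fun p : (Code × SearchState) × List ℕ => p.1.1 :=
    Primrec.fst.comp Primrec.fst
  have hs : Primrec fun p : (Code × SearchState) × List ℕ => p.1.2 :=
    Primrec.snd.comp Primrec.fst
  have hv : Primrec fun p : (Code × SearchState) × List ℕ => p.2 := Primrec.snd
  have hL := Primrec.fst.comp hs
  have hk := Primrec.fst.comp (Primrec.snd.comp hs)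
  have hD := Primrec.snd.comp (Primrec.snd.comp hs)
  have hm := Primrec.fst.comp (Primrec.unpair.comp (Primrec.snd.comp (Primrec.unpair.comp hk)))
  have hΓ := (primrec_encS_ctx S Δ).comp hL
  have hdelay : ∀ {L : (Code × SearchState) × List ℕ → List Clo}
      {D : (Code × SearchState) × List ℕ → Clo}, Primrec L → Primrec D →
      Primrec fun p => delay S Δ p.1.1 (L p, p.1.2.2.1 + 1, D p) := fun hL hD =>
    (primrec_delay S Δ).comp hc (hL.pair ((Primrec.succ.comp hk).pair hD))
  have hnil : Primrec fun _ : (Code × SearchState) × List ℕ => ([] : List ℕ) := Primrec.const []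
  have hax : Primrec fun p : (Code × SearchState) × List ℕ =>
      tup [axC, encS (ctx S Δ p.1.2.1)] :=
    primrec_tup.comp (primrec_cons (Primrec.const _) (primrec_cons hΓ hnil))
  have hsnoc : ∀ {y : (Code × SearchState) × List ℕ → Clo}, Primrec y →
      Primrec fun p => p.1.2.1 ++ [y p] := fun hy =>
    Primrec.list_append.comp hL (Primrec.list_cons.comp hy (Primrec.const []))
  cases C with
  | eq t u =>
    exact Primrec.ite (Primrec.eq.comp (t.primrec_val.comp hv) (u.primrec_val.comp hv)) hax
      (hdelay hL hD)
  | ne t u =>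
    exact Primrec.ite (Primrec.eq.comp (t.primrec_val.comp hv) (u.primrec_val.comp hv))
      (hdelay hL hD) hax
  | and A B =>
    exact primrec_tup.comp (primrec_cons (Primrec.const _) (primrec_cons hΓ
      (primrec_cons ((primrec_encF_closeS (.and A B)).comp hv)
        (primrec_cons (hdelay (hsnoc ((Primrec.const _).pair hv)) hD)
          (primrec_cons (hdelay (hsnoc ((Primrec.const _).pair hv)) hD) hnil)))))
  | or A B =>
    refine primrec_tup.comp (primrec_cons (Primrec.const _) (primrec_cons hΓ
      (primrec_cons ((primrec_encF_closeS (.or A B)).comp hv)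
        (primrec_cons (hdelay ?_ hD) hnil))))
    exact Primrec.list_append.comp hL (Primrec.list_cons.comp ((Primrec.const _).pair hv)
      (Primrec.list_cons.comp ((Primrec.const _).pair hv) (Primrec.const [])))
  | all A => exact hdelay hL ((Primrec.const _).pair hv)
  | ex A =>
    exact primrec_tup.comp (primrec_cons (Primrec.const _) (primrec_cons hΓ
      (primrec_cons ((primrec_encF_closeS (.ex A)).comp hv)
        (primrec_cons (hdelay (hsnoc ((Primrec.const _).pair (primrec_cons hm hv))) hD) hnil))))

theorem primrec_searchStep (S : List Fml) (Δ : List Sentence) : Primrec₂ (searchStep S Δ) := by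
  have hs : Primrec fun p : Code × SearchState => p.2 := Primrec.snd
  have hL := Primrec.fst.comp hs
  have hk := Primrec.fst.comp (Primrec.snd.comp hs)
  have hD := Primrec.snd.comp (Primrec.snd.comp hs)
  have hact : Primrec₂ fun (p : Code × SearchState) (x : Clo) =>
      act S Δ p.1 p.2 x.2 (fmlAt S x.1) :=
    ((primrec₂_fmlAt (primrec_act S Δ) S).comp (Primrec.fst.comp Primrec.snd)
      (Primrec.fst.pair (Primrec.snd.comp Primrec.snd))).to₂
  refine (Primrec.option_casesOn
    (Primrec.list_getElem?.comp hL (Primrec.fst.comp (Primrec.unpair.comp hk)))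
    ((primrec_delay S Δ).comp Primrec.fst (hL.pair ((Primrec.succ.comp hk).pair hD))) hact).of_eq
    fun p => ?_
  simp only [searchStep]
  cases p.2.1[p.2.2.1.unpair.1]? <;> rfl

theorem primrec_searchFun (S : List Fml) (Δ : List Sentence) : Primrec₂ (searchFun S Δ) := by
  have hx : Primrec fun p : Code × ℕ => p.2.unpair := Primrec.unpair.comp Primrec.snd
  have hs : Primrec fun p : Code × ℕ =>
      (decode (α := SearchState) p.2.unpair.1).getD ([], 0, 0, []) :=
    Primrec.option_getD.comp (Primrec.decode.comp (Primrec.fst.comp hx)) (Primrec.const _)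
  have hD := Primrec.snd.comp (Primrec.snd.comp hs)
  refine (primrec_searchStep S Δ).comp Primrec.fst (Primrec.pair ?_ (Primrec.snd.comp hs))
  exact Primrec.list_append.comp (Primrec.fst.comp hs) (Primrec.list_cons.comp
    ((Primrec.fst.comp hD).pair (primrec_cons (Primrec.snd.comp hx) (Primrec.snd.comp hD)))
    (Primrec.const []))

theorem exists_code_eval_eq_searchFun (S : List Fml) (Δ : List Sentence) :
    ∃ c : Code, ∀ x, c.eval x = Part.some (searchFun S Δ c x) := by
  obtain ⟨c, hc⟩ := Code.fixed_point₂ (f := fun c x => Part.some (searchFun S Δ c x))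
    (primrec_searchFun S Δ).to_comp.partrec₂
  exact ⟨c, fun x => congrFun hc x⟩

theorem peval_curry {S : List Fml} {Δ : List Sentence} {c : Code}
    (hc : ∀ x, c.eval x = Part.some (searchFun S Δ c x)) (s : SearchState) (n : ℕ) :
    peval (encode (c.curry (encode s))) n = Part.some (searchStep S Δ c (s.inst n)) := by
  rw [peval, Denumerable.ofNat_encode, Code.eval_curry, hc]
  rw [searchFun, Nat.unpair_pair, encodek]
  rfl

theorem primIndex_curry {S : List Fml} {Δ : List Sentence} {c : Code}
    (hc : ∀ x, c.eval x = Part.some (searchFun S Δ c x)) (s : SearchState) :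
    PrimIndex (encode (c.curry (encode s))) := by
  refine ⟨fun n => searchFun S Δ c (Nat.pair (encode s) n), ?_, fun n => ?_⟩
  · exact Primrec.nat_iff.1 ((primrec_searchFun S Δ).comp (Primrec.const c)
      (Primrec₂.natPair.comp (Primrec.const _) Primrec.id))
  · rw [peval, Denumerable.ofNat_encode, Code.eval_curry, hc]

end Primrec

/-! ### Subformulas -/

/-- The immediate subformulas of a formula. -/
def Fml.parts : Fml → List Fml
  | .eq _ _ => []
  | .ne _ _ => []
  | .and A B => [A, B]
  | .or A B => [A, B]
  | .all A => [A]
  | .ex A => [A]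

/-- The subformulas of a formula. -/
def Fml.subs : Fml → List Fml
  | .eq t u => [.eq t u]
  | .ne t u => [.ne t u]
  | .and A B => .and A B :: (A.subs ++ B.subs)
  | .or A B => .or A B :: (A.subs ++ B.subs)
  | .all A => .all A :: A.subs
  | .ex A => .ex A :: A.subs

theorem Fml.self_mem_subs (A : Fml) : A ∈ A.subs := by cases A <;> simp [Fml.subs]

theorem Fml.sizeOf_lt_of_mem_parts {P C : Fml} (h : P ∈ C.parts) : sizeOf P < sizeOf C := by
  cases C <;> simp only [Fml.parts, List.mem_cons, List.not_mem_nil, or_false] at h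
  case and | or => rcases h with rfl | rfl <;>
    (simp only [Fml.and.sizeOf_spec, Fml.or.sizeOf_spec]; omega)
  all_goals subst h; simp

/-- Closure of a list of formulas under immediate subformulas. -/
def SubClosed (S : List Fml) : Prop := ∀ C ∈ S, ∀ P ∈ C.parts, P ∈ S

theorem Fml.subClosed_subs (A : Fml) : SubClosed A.subs := by
  induction A with
  | eq | ne => simp [SubClosed, Fml.subs, Fml.parts]
  | and A B ihA ihB | or A B ihA ihB =>
    simp only [SubClosed, Fml.subs, List.mem_cons, List.mem_append]
    rintro C (rfl | hC | hC) P hP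
    · simp only [Fml.parts, List.mem_cons, List.not_mem_nil, or_false] at hP
      rcases hP with rfl | rfl <;> simp [Fml.self_mem_subs]
    · exact Or.inr (Or.inl (ihA C hC P hP))
    · exact Or.inr (Or.inr (ihB C hC P hP))
  | all A ih | ex A ih =>
    simp only [SubClosed, Fml.subs, List.mem_cons]
    rintro C (rfl | hC) P hP
    · simp only [Fml.parts, List.mem_cons, List.not_mem_nil, or_false] at hP
      simp [hP, Fml.self_mem_subs]
    · exact Or.inr (ih C hC P hP)

theorem SubClosed.mem_of_mem_parts_fmlAt {S : List Fml} (hS : SubClosed S) (i : ℕ) {P : Fml}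
    (h : P ∈ (fmlAt S i).parts) : P ∈ S := by
  by_cases hi : i < S.length
  · rw [fmlAt, List.getD_eq_getElem _ _ hi] at h
    exact hS _ (List.getElem_mem hi) _ h
  · rw [fmlAt, List.getD_eq_default _ _ (not_lt.1 hi)] at h
    simp [Fml.parts] at h

theorem fmlAt_idxOf {S : List Fml} {P : Fml} (h : P ∈ S) : fmlAt S (S.idxOf P) = P := by
  rw [fmlAt, List.getD_eq_getElem _ _ (List.idxOf_lt_length_of_mem h), List.getElem_idxOf]

/-! ### Correctness of the proof search -/

section Search

variable {S : List Fml} {Δ : List Sentence} {c : Code}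

theorem ctx_append (L M : List Clo) :
    ctx S Δ (L ++ M) = ctx S Δ L ∪ (M.map (cloS S)).toFinset := by
  simp [ctx, Finset.union_assoc]

theorem ctx_snoc (L : List Clo) (x : Clo) : ctx S Δ (L ++ [x]) = ctx S Δ L ∪ {cloS S x} := by
  simp [ctx_append]

theorem cloS_mem_ctx {L : List Clo} {x : Clo} (h : x ∈ L) : cloS S x ∈ ctx S Δ L := by
  simpa [ctx] using Or.inr ⟨_, _, h, rfl⟩

variable (S Δ) in
/-- The delaying formula of a search state is in its sequent. -/
def SearchState.Good (s : SearchState) : Prop := cloAll S s.2.2 ∈ ctx S Δ s.1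

theorem SearchState.Good.append {s : SearchState} (h : s.Good S Δ) (L : List Clo) (k : ℕ) :
    SearchState.Good S Δ (s.1 ++ L, k, s.2.2) := by
  rw [SearchState.Good, ctx_append]
  exact Finset.mem_union_left _ h

theorem SearchState.Good.inst {s : SearchState} (h : s.Good S Δ) (n : ℕ) : (s.inst n).Good S Δ :=
  h.append _ _

theorem union_singleton_of_mem {Γ : Finset Sentence} {A : Sentence} (h : A ∈ Γ) : Γ ∪ {A} = Γ :=
  Finset.union_eq_left.2 (Finset.singleton_subset_iff.2 h)

theorem EndS_delay {s : SearchState} (h : s.Good S Δ) : EndS (delay S Δ c s) = ctx S Δ s.1 := by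
  rw [delay, EndS_main (by simp), union_singleton_of_mem h]

variable (S) in
/-- The search states of the premises of the inference performed for a formula. -/
def Child (s : SearchState) (v : List ℕ) : Fml → SearchState → Prop
  | .eq t u, s' => t.val (env v) ≠ u.val (env v) ∧ s' = (s.1 ++ [], s.2.1 + 1, s.2.2)
  | .ne t u, s' => t.val (env v) = u.val (env v) ∧ s' = (s.1 ++ [], s.2.1 + 1, s.2.2)
  | .and A B, s' => s' = (s.1 ++ [(S.idxOf A, v)], s.2.1 + 1, s.2.2) ∨
      s' = (s.1 ++ [(S.idxOf B, v)], s.2.1 + 1, s.2.2)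
  | .or A B, s' => s' = (s.1 ++ [(S.idxOf A, v), (S.idxOf B, v)], s.2.1 + 1, s.2.2)
  | .all A, s' => s' = (s.1 ++ [], s.2.1 + 1, (S.idxOf A, v))
  | .ex A, s' => s' = (s.1 ++ [(S.idxOf A, s.2.1.unpair.2.unpair.1 :: v)], s.2.1 + 1, s.2.2)

theorem Child.exists_append {s s' : SearchState} {v : List ℕ} {C : Fml} (h : Child S s v C s') :
    ∃ L, s'.1 = s.1 ++ L ∧ s'.2.1 = s.2.1 + 1 := by
  cases C
  case eq | ne => exact ⟨_, by rw [h.2], by rw [h.2]⟩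
  case and => rcases h with rfl | rfl <;> exact ⟨_, rfl, rfl⟩
  all_goals cases h; exact ⟨_, rfl, rfl⟩

theorem cloAll_idxOf {A : Fml} (hA : A ∈ S) (v : List ℕ) :
    cloAll S (S.idxOf A, v) = closeS (env v) (.all A) := by
  rw [cloAll, fmlAt_idxOf hA]

theorem cloS_idxOf {A : Fml} (hA : A ∈ S) (v : List ℕ) :
    cloS S (S.idxOf A, v) = closeS (env v) A := by
  rw [cloS, fmlAt_idxOf hA]

theorem good_all {s : SearchState} {v : List ℕ} {A : Fml} (hA : A ∈ S)
    (hC : closeS (env v) (.all A) ∈ ctx S Δ s.1) (k : ℕ) :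
    SearchState.Good S Δ (s.1, k, (S.idxOf A, v)) := by
  rwa [SearchState.Good, cloAll_idxOf hA]

theorem Child.good {s s' : SearchState} {v : List ℕ} {C : Fml} (h : Child S s v C s')
    (hparts : ∀ P ∈ C.parts, P ∈ S) (hC : closeS (env v) C ∈ ctx S Δ s.1) (hs : s.Good S Δ) :
    s'.Good S Δ := by
  cases C
  case eq | ne => rw [h.2]; exact hs.append _ _
  case and => rcases h with rfl | rfl <;> exact hs.append _ _
  case all => cases h; rw [List.append_nil]; exact good_all (hparts _ (by simp [Fml.parts])) hC _
  all_goals cases h; exact hs.append _ _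

theorem Child.exists_sat {s s' : SearchState} {v : List ℕ} {C : Fml} (h : Child S s v C s')
    (hsat : C.Sat (env v))
    (hex : ∀ A, C = .ex A → A.Sat (env (s.2.1.unpair.2.unpair.1 :: v))) (n : ℕ) :
    ∃ P ∈ C.parts, ∃ w, P.Sat (env w) ∧ (S.idxOf P, w) ∈ (s'.inst n).1 := by
  cases C with
  | eq t u => exact absurd hsat h.1
  | ne t u => exact absurd h.1 hsat
  | and A B =>
    rcases h with rfl | rfl
    · exact ⟨A, by simp [Fml.parts], v, hsat.1, by simp [SearchState.inst]⟩
    · exact ⟨B, by simp [Fml.parts], v, hsat.2, by simp [SearchState.inst]⟩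
  | or A B =>
    cases h
    rcases hsat with hsat | hsat
    · exact ⟨A, by simp [Fml.parts], v, hsat, by simp [SearchState.inst]⟩
    · exact ⟨B, by simp [Fml.parts], v, hsat, by simp [SearchState.inst]⟩
  | all A =>
    cases h
    exact ⟨A, by simp [Fml.parts], n :: v, consEnv_env n v ▸ hsat n, by simp [SearchState.inst]⟩
  | ex A =>
    cases h
    exact ⟨A, by simp [Fml.parts], _, hex A rfl, by simp [SearchState.inst]⟩

theorem EndS_act {s : SearchState} {v : List ℕ} {C : Fml} (hparts : ∀ P ∈ C.parts, P ∈ S)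
    (hC : closeS (env v) C ∈ ctx S Δ s.1) (hs : s.Good S Δ) :
    EndS (act S Δ c s v C) = ctx S Δ s.1 := by
  cases C with
  | eq t u =>
    rw [act]
    split_ifs
    · exact EndS_ax _
    · exact EndS_delay hs
  | ne t u =>
    rw [act]
    split_ifs
    · exact EndS_delay hs
    · exact EndS_ax _
  | and A B => rw [act, EndS_main (by simp), union_singleton_of_mem hC]
  | or A B => rw [act, EndS_main (by simp), union_singleton_of_mem hC]
  | ex A => rw [act, EndS_main (by simp), union_singleton_of_mem hC]
  | all A =>
    rw [act, EndS_delay (good_all (hparts A (by simp [Fml.parts])) hC _)]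

theorem act_mem {s : SearchState} {v : List ℕ} {C : Fml} (hparts : ∀ P ∈ C.parts, P ∈ S)
    (hC : closeS (env v) C ∈ ctx S Δ s.1) (hs : s.Good S Δ)
    (h : ∀ s', Child S s v C s' → CprecM (delay S Δ c s')) : CprecM (act S Δ c s v C) := by
  cases C with
  | eq t u =>
    rw [act]
    split_ifs with htu
    · exact .ax _ ⟨_, hC, rfl, (sentTrue_closeS _ _).2 htu⟩
    · simpa using h _ ⟨htu, rfl⟩
  | ne t u =>
    rw [act]
    split_ifs with htu
    · simpa using h _ ⟨htu, rfl⟩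
    · exact .ax _ ⟨_, hC, rfl, (sentTrue_closeS _ _).2 htu⟩
  | and A B =>
    have hA : A ∈ S := hparts A (by simp [Fml.parts])
    have hB : B ∈ S := hparts B (by simp [Fml.parts])
    refine CGen.and _ (closeS (env v) A) (closeS (env v) B) (h _ (Or.inl rfl)) (h _ (Or.inr rfl))
      ?_ ?_
    · rw [EndS_delay (hs.append _ _), ctx_snoc, cloS_idxOf hA]
    · rw [EndS_delay (hs.append _ _), ctx_snoc, cloS_idxOf hB]
  | or A B =>
    have hA : A ∈ S := hparts A (by simp [Fml.parts])
    have hB : B ∈ S := hparts B (by simp [Fml.parts])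
    refine CGen.or _ (closeS (env v) A) (closeS (env v) B) (h _ rfl) ?_
    rw [EndS_delay (hs.append _ _), ctx_append]
    simp [cloS_idxOf hA, cloS_idxOf hB]
  | all A => simpa [act] using h _ rfl
  | ex A =>
    have hA : A ∈ S := hparts A (by simp [Fml.parts])
    refine CGen.ex _ _ (Fml.cu_close (env v) A 1) s.2.1.unpair.2.unpair.1 (h _ rfl) ?_
    rw [EndS_delay (hs.append _ _), ctx_snoc, cloS_idxOf hA, sInst_close, consEnv_env]

theorem cloS_mem_of_getElem? {L : List Clo} {j : ℕ} {x : Clo} (h : L[j]? = some x) :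
    closeS (env x.2) (fmlAt S x.1) ∈ ctx S Δ L :=
  cloS_mem_ctx (List.mem_of_getElem? h)

theorem EndS_searchStep (hS : SubClosed S) {s : SearchState} (hs : s.Good S Δ) :
    EndS (searchStep S Δ c s) = ctx S Δ s.1 := by
  rw [searchStep]
  split
  · exact EndS_delay hs
  · next x hx =>
    exact EndS_act (fun P => hS.mem_of_mem_parts_fmlAt x.1) (cloS_mem_of_getElem? hx) hs

theorem delay_mem (hS : SubClosed S) (hc : ∀ x, c.eval x = Part.some (searchFun S Δ c x))
    {s : SearchState} (hs : s.Good S Δ) (h : ∀ n, CprecM (searchStep S Δ c (s.inst n))) :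
    CprecM (delay S Δ c s) := by
  have hget : ∀ n (hn : (peval (encode (c.curry (encode s))) n).Dom),
      (peval (encode (c.curry (encode s))) n).get hn = searchStep S Δ c (s.inst n) := fun n _ =>
    Part.get_eq_of_mem (by rw [peval_curry hc]; exact Part.mem_some _) _
  refine CGen.om _ _ (Fml.cu_close (env s.2.2.2) (fmlAt S s.2.2.1) 1)
    (fun _ => primIndex_curry hc s) (fun n => by rw [peval_curry hc]; trivial) ?_ ?_
  · intro n
    rw [hget]
    exact h n
  · intro n
    rw [hget, EndS_searchStep hS (hs.inst n), sInst_close, consEnv_env, SearchState.inst, ctx_snoc,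
      cloS]

/-- The search succeeds as soon as a true sentence has been collected. -/
theorem searchStep_mem (hS : SubClosed S) (hc : ∀ x, c.eval x = Part.some (searchFun S Δ c x))
    {s : SearchState} (hs : s.Good S Δ) {x : Clo} (hx : x ∈ s.1)
    (hsat : (fmlAt S x.1).Sat (env x.2)) : CprecM (searchStep S Δ c s) := by
  induction hN : sizeOf (fmlAt S x.1) using Nat.strong_induction_on generalizing s x with
  | _ N ih =>
    subst hN
    obtain ⟨j, hj⟩ := List.mem_iff_getElem?.1 hx
    obtain ⟨m, hm⟩ : ∃ m, ∀ A, fmlAt S x.1 = .ex A → A.Sat (env (m :: x.2)) := by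
      by_cases hC : ∃ A, fmlAt S x.1 = .ex A
      · obtain ⟨A, hA⟩ := hC
        rw [hA] at hsat
        obtain ⟨m, hm⟩ := hsat
        refine ⟨m, fun A' hA' => ?_⟩
        rw [hA] at hA'
        cases hA'
        rwa [consEnv_env] at hm
      · exact ⟨0, fun A hA => absurd ⟨A, hA⟩ hC⟩
    have key : ∀ (r : ℕ) (s : SearchState), s.Good S Δ → s.1[j]? = some x →
        (s.2.1 + r).unpair.1 = j → (s.2.1 + r).unpair.2.unpair.1 = m →
        CprecM (searchStep S Δ c s) := by
      intro r
      induction r with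
      | zero =>
        intro s hs hj h1 h2
        rw [Nat.add_zero] at h1 h2
        have hparts := fun P => hS.mem_of_mem_parts_fmlAt (P := P) x.1
        have hC : closeS (env x.2) (fmlAt S x.1) ∈ ctx S Δ s.1 := cloS_mem_of_getElem? hj
        rw [searchStep, h1, hj]
        refine act_mem hparts hC hs fun s' hs' => delay_mem hS hc (hs'.good hparts hC hs) fun n => ?_
        obtain ⟨P, hP, w, hw, hmem⟩ := hs'.exists_sat hsat (h2.symm ▸ hm) n
        have hPS := fmlAt_idxOf (hparts P hP)
        refine ih _ ?_ ((hs'.good hparts hC hs).inst n) hmem ?_ rfl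
        · simp only [hPS]
          exact Fml.sizeOf_lt_of_mem_parts hP
        · simpa only [hPS] using hw
      | succ r ihr =>
        intro s hs hj h1 h2
        have next : ∀ s' : SearchState, s'.Good S Δ →
            (∃ L, s'.1 = s.1 ++ L ∧ s'.2.1 = s.2.1 + 1) → CprecM (delay S Δ c s') := by
          rintro s' hs' ⟨L, hL, hk⟩
          refine delay_mem hS hc hs' fun n => ihr _ (hs'.inst n) ?_ ?_ ?_
          · have hlt := (List.getElem?_eq_some_iff.1 hj).1
            simp only [SearchState.inst, hL, List.append_assoc]
            rw [List.getElem?_append_left hlt, hj]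
          · rw [← h1, SearchState.inst, hk, Nat.add_assoc, Nat.add_comm 1]
          · rw [← h2, SearchState.inst, hk, Nat.add_assoc, Nat.add_comm 1]
        rw [searchStep]
        split
        · exact next _ hs ⟨[], (List.append_nil _).symm, rfl⟩
        · next y hy =>
          have hparts := fun P => hS.mem_of_mem_parts_fmlAt (P := P) y.1
          have hC : closeS (env y.2) (fmlAt S y.1) ∈ ctx S Δ s.1 := cloS_mem_of_getElem? hy
          exact act_mem hparts hC hs fun s' hs' => next s' (hs'.good hparts hC hs) hs'.exists_append
    have hle : s.2.1 ≤ Nat.pair j (Nat.pair m s.2.1) :=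
      (Nat.right_le_pair _ _).trans (Nat.right_le_pair _ _)
    refine key (Nat.pair j (Nat.pair m s.2.1) - s.2.1) s hs hj ?_ ?_ <;>
      simp [Nat.add_sub_cancel' hle]

/-! ### The search yields primitive recursive `ω`-proofs -/

/-- Recover the argument `s` from the code of `c.curry s`. -/
def uncurryArg (c : Code) (e : ℕ) : ℕ := Nat.findGreatest (fun s => encode (c.curry s) = e) e

theorem le_encode_const (n : ℕ) : n ≤ encode (Code.const n) := by
  induction n with
  | zero => exact Nat.zero_le _
  | succ n ih => exact ih.trans_lt (Code.encode_lt_comp _ _).2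

theorem le_encode_curry (c : Code) (s : ℕ) : s ≤ encode (c.curry s) :=
  (le_encode_const s).trans
    ((Code.encode_lt_pair _ _).1.trans (Code.encode_lt_comp c _).2).le

theorem uncurryArg_encode_curry (c : Code) (s : ℕ) : uncurryArg c (encode (c.curry s)) = s := by
  have h := Nat.findGreatest_spec (P := fun t => encode (c.curry t) = encode (c.curry s))
    (le_encode_curry c s) rfl
  exact (Code.curry_inj (encode_injective h)).2

theorem primrec_uncurryArg (c : Code) : Primrec (uncurryArg c) :=
  Primrec.nat_findGreatest Primrec.id (Primrec.eq.comp
    (Primrec.encode.comp (Code.primrec₂_curry.comp (Primrec.const c) Primrec.snd)) Primrec.fst)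

variable (S Δ c) in
/-- A primitive recursive function that agrees with `childCode` on the codes of the search. -/
def searchChild (b n : ℕ) : ℕ :=
  if proj b 0 = omC then searchFun S Δ c (Nat.pair (uncurryArg c (proj b 3)) n)
  else if proj b 0 = andC ∨ proj b 0 = orC ∨ proj b 0 = exC ∨ proj b 0 = cutC then proj b (n + 3)
  else 0

theorem primrec_untup : Primrec untup := (Primrec.ofNat _).comp Primrec.pred

theorem primrec₂_proj : Primrec₂ proj :=
  (Primrec.list_getD 0).comp (primrec_untup.comp Primrec.fst) Primrec.snd

theorem primrec_proj_const (i : ℕ) : Primrec fun b => proj b i :=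
  primrec₂_proj.comp Primrec.id (Primrec.const i)

theorem primrecPred_proj_zero (R : ℕ) : PrimrecPred fun b => proj b 0 = R :=
  Primrec.eq.comp (primrec_proj_const 0) (Primrec.const R)

theorem primrec₂_searchChild : Primrec₂ (searchChild S Δ c) := by
  have h : ∀ R, PrimrecPred fun p : ℕ × ℕ => proj p.1 0 = R := fun R =>
    Primrec.eq.comp ((primrec_proj_const 0).comp Primrec.fst) (Primrec.const R)
  refine Primrec.ite (h _) ?_ (Primrec.ite ((h _).or ((h _).or ((h _).or (h _)))) ?_
    (Primrec.const 0))
  · exact (primrec_searchFun S Δ).comp (Primrec.const c) (Primrec₂.natPair.comp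
      ((primrec_uncurryArg c).comp ((primrec_proj_const 3).comp Primrec.fst)) Primrec.snd)
  · exact primrec₂_proj.comp Primrec.fst (Primrec.nat_add.comp Primrec.snd (Primrec.const 3))

theorem primrec_nodeVal : Primrec nodeVal := by
  have h := primrecPred_proj_zero
  have hp := primrec_proj_const
  refine Primrec.ite (h _) ?_ (Primrec.ite ((h _).or ((h _).or ((h _).or ((h _).or (h _))))) ?_
    (Primrec.const 0))
  · exact primrec_tup.comp (primrec_cons (Primrec.const _) (primrec_cons (hp 1) (Primrec.const [])))
  · exact primrec_tup.comp (primrec_cons (hp 0) (primrec_cons (hp 1) (primrec_cons (hp 2)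
      (Primrec.const []))))

variable (S Δ c) in
/-- The codes that occur in the search. -/
inductive SearchNode : ℕ → Prop
  | zero : SearchNode 0
  | ax (g : ℕ) : SearchNode (tup [axC, g])
  | delay (s : SearchState) : SearchNode (delay S Δ c s)
  | finite {R : ℕ} (hR : R = andC ∨ R = orC ∨ R = exC) (g x : ℕ) (l : List SearchState) :
      SearchNode (tup (R :: g :: x :: l.map (Shoen.delay S Δ c)))

theorem searchNode_searchStep (s : SearchState) : SearchNode S Δ c (searchStep S Δ c s) := by
  rw [searchStep]
  split
  · exact .delay _
  · next x _ =>
    cases fmlAt S x.1 with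
    | eq t u | ne t u =>
      simp only [act]
      split
      all_goals first | exact .ax _ | exact .delay _
    | and A B => exact .finite (by simp) _ _ [_, _]
    | or A B => exact .finite (by simp) _ _ [_]
    | all A => exact .delay _
    | ex A => exact .finite (by simp) _ _ [_]

theorem SearchNode.childCode_eq (hc : ∀ x, c.eval x = Part.some (searchFun S Δ c x)) {b : ℕ}
    (h : SearchNode S Δ c b) (n : ℕ) :
    childCode b n = searchChild S Δ c b n ∧ SearchNode S Δ c (childCode b n) := by
  cases h with
  | zero =>
    rw [childCode_zero]
    exact ⟨by simp [searchChild, proj_zero, omC, andC, orC, exC, cutC], .zero⟩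
  | ax g =>
    rw [childCode_ax]
    exact ⟨by simp [searchChild, proj_tup, axC, omC, andC, orC, exC, cutC], .zero⟩
  | delay s =>
    rw [Shoen.delay, childCode_om (peval_curry hc s n)]
    refine ⟨?_, searchNode_searchStep _⟩
    simp only [searchChild, proj_tup, List.getD_cons_zero, List.getD_cons_succ, if_true,
      uncurryArg_encode_curry]
    rw [searchFun, Nat.unpair_pair, encodek]
    rfl
  | @finite R hR g x l =>
    rw [childCode_finite hR]
    constructor
    · have hom : R ≠ omC := by rcases hR with rfl | rfl | rfl <;> simp [omC, andC, orC, exC]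
      have hfin : R = andC ∨ R = orC ∨ R = exC ∨ R = cutC := by tauto
      simp only [searchChild, proj_tup, List.getD_cons_zero, List.getD_cons_succ, if_neg hom,
        if_pos hfin]
    · by_cases hn : n < (l.map (Shoen.delay S Δ c)).length
      · rw [List.getD_eq_getElem _ _ hn, List.getElem_map]
        exact .delay _
      · rw [List.getD_eq_default _ _ (not_lt.1 hn)]
        exact .zero

theorem SearchNode.walkCode_eq (hc : ∀ x, c.eval x = Part.some (searchFun S Δ c x)) {b : ℕ}
    (h : SearchNode S Δ c b) (l : List ℕ) : walkCode b l = l.foldl (searchChild S Δ c) b := by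
  induction l generalizing b with
  | nil => rfl
  | cons i l ih =>
    obtain ⟨h1, h2⟩ := h.childCode_eq hc i
    rw [walkCode, ih h2, h1, List.foldl_cons]

theorem primrec_piOf_delay (hc : ∀ x, c.eval x = Part.some (searchFun S Δ c x))
    (s : SearchState) : Primrec (piOf (delay S Δ c s)) := by
  refine (Primrec.ite (Primrec.eq.comp Primrec.id (Primrec.const 0)) (Primrec.const 0)
    (primrec_nodeVal.comp (Primrec.list_foldl (h := fun _ p => searchChild S Δ c p.1 p.2)
      primrec_untup (Primrec.const (delay S Δ c s))
      (primrec₂_searchChild.comp (Primrec.fst.comp Primrec.snd)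
        (Primrec.snd.comp Primrec.snd)).to₂))).of_eq fun σ => ?_
  rw [piOf, (SearchNode.delay s).walkCode_eq hc]
  rfl

end Search

/-! ### Completeness -/

theorem piOf_zero : piOf 0 = fun _ => 0 := by
  funext σ
  simp [piOf, walkCode_zero, nodeVal_zero]

theorem primrec_piOf_of_childCode {b : ℕ} {l : List ℕ} (h : ∀ i, childCode b i = l.getD i 0)
    (hl : ∀ a ∈ l, Primrec (piOf a)) : Primrec (piOf b) := by
  have hget : Primrec₂ fun i τ => piOf (l.getD i 0) τ := by
    clear h
    induction l with
    | nil => simpa [piOf_zero] using (Primrec.const 0).to₂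
    | cons a l ih =>
      refine (Primrec.nat_casesOn Primrec.fst ((hl a (by simp)).comp Primrec.snd)
        ((ih fun a ha => hl a (List.mem_cons_of_mem _ ha)).comp Primrec.snd
          (Primrec.snd.comp Primrec.fst)).to₂).of_eq fun p => ?_
      rcases p with ⟨_ | i, τ⟩ <;> rfl
  refine (Primrec.ite (Primrec.eq.comp Primrec.id (Primrec.const 0)) (Primrec.const 0)
    (Primrec.list_casesOn (h := fun _ p => piOf (l.getD p.1 0) (tup p.2)) primrec_untup
      (Primrec.const (nodeVal b))
      (hget.comp (Primrec.fst.comp Primrec.snd)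
        (primrec_tup.comp (Primrec.snd.comp Primrec.snd))).to₂)).of_eq fun σ => ?_
  rw [piOf]
  refine if_congr Iff.rfl rfl ?_
  cases hσ : untup σ with
  | nil => rfl
  | cons i τ => simp only [walkCode, h, piOf_eq (tup_ne_zero _), untup_tup]

theorem exists_cprecM_of_sat_all (A : Fml) (v : List ℕ) (hsat : (Fml.all A).Sat (env v))
    (Γ : Finset Sentence) : ∃ a, CprecM a ∧ EndS a = Γ ∪ {closeS (env v) (.all A)} ∧
      Primrec (piOf a) := by
  obtain ⟨c, hc⟩ := exists_code_eval_eq_searchFun A.subs (Γ.toList ++ [closeS (env v) (.all A)])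
  have hA := A.self_mem_subs
  have hS := A.subClosed_subs
  have hs : SearchState.Good A.subs (Γ.toList ++ [closeS (env v) (.all A)])
      ([], 0, (A.subs.idxOf A, v)) := by
    rw [SearchState.Good, cloAll_idxOf hA]
    simp [ctx]
  refine ⟨_, delay_mem hS hc hs fun n => ?_, ?_, primrec_piOf_delay hc _⟩
  · refine searchStep_mem hS hc (hs.inst n) (x := (A.subs.idxOf A, n :: v))
      (by simp [SearchState.inst]) ?_
    simp only [fmlAt_idxOf hA, ← consEnv_env]
    exact hsat n
  · rw [EndS_delay hs]
    ext B
    simp [ctx]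

theorem exists_cprecM_of_sat (C : Fml) : ∀ v, C.Sat (env v) → ∀ Γ : Finset Sentence,
    ∃ a, CprecM a ∧ EndS a = Γ ∪ {closeS (env v) C} ∧ Primrec (piOf a) := by
  have hax : ∀ (C : Fml) (v : List ℕ), (C.close (env v) 0).isLiteral = true → C.Sat (env v) →
      ∀ Γ : Finset Sentence,
        ∃ a, CprecM a ∧ EndS a = Γ ∪ {closeS (env v) C} ∧ Primrec (piOf a) :=
    fun C v hl hsat Γ => ⟨_, .ax _ ⟨closeS (env v) C, by simp, hl, (sentTrue_closeS _ _).2 hsat⟩,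
      EndS_ax _, primrec_piOf_of_childCode (l := []) (fun i => by simp [childCode_ax]) (by simp)⟩
  induction C with
  | eq t u => exact fun v => hax _ v rfl
  | ne t u => exact fun v => hax _ v rfl
  | and A B ihA ihB =>
    intro v hsat Γ
    obtain ⟨a, ha, ea, pa⟩ := ihA v hsat.1 Γ
    obtain ⟨b, hb, eb, pb⟩ := ihB v hsat.2 Γ
    exact ⟨_, .and Γ _ _ ha hb ea eb, EndS_main (by simp) _ _ _,
      primrec_piOf_of_childCode (childCode_finite (by simp) _ _ · [a, b]) (by simp [pa, pb])⟩
  | or A B ihA ihB =>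
    intro v hsat Γ
    obtain ⟨a, ha, ea, pa⟩ : ∃ a, CprecM a ∧
        EndS a = Γ ∪ {closeS (env v) A, closeS (env v) B} ∧ Primrec (piOf a) := by
      rcases hsat with hsat | hsat
      · obtain ⟨a, ha, ea, pa⟩ := ihA v hsat (Γ ∪ {closeS (env v) B})
        refine ⟨a, ha, ?_, pa⟩
        rw [ea]
        ext
        simp
        tauto
      · obtain ⟨a, ha, ea, pa⟩ := ihB v hsat (Γ ∪ {closeS (env v) A})
        refine ⟨a, ha, ?_, pa⟩
        rw [ea]
        ext
        simp
    exact ⟨_, .or Γ _ _ ha ea, EndS_main (by simp) _ _ _,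
      primrec_piOf_of_childCode (childCode_finite (by simp) _ _ · [a]) (by simp [pa])⟩
  | all A _ => exact exists_cprecM_of_sat_all A
  | ex A ih =>
    rintro v ⟨n, hn⟩ Γ
    rw [consEnv_env] at hn
    obtain ⟨a, ha, ea, pa⟩ := ih _ hn Γ
    rw [← consEnv_env, ← sInst_close] at ea
    exact ⟨_, .ex Γ _ _ n ha ea, EndS_main (by simp) _ _ _,
      primrec_piOf_of_childCode (childCode_finite (by simp) _ _ · [a]) (by simp [pa])⟩

end Completeness

/-- **Completeness of the cut free primitive recursive `ω`-rule.**  A sentence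
`A` is true in `ℕ` iff it has a code in `C_prec^-`; moreover a true sentence
has a code in `C_prec^-` of a primitive recursive cut free `ω`-proof.  Hence
`thm(C_prec^-)` is the set of true arithmetical sentences. -/
theorem cprec_minus_completeness (A : Sentence) :
    (sentTrue A → ∃ a : ℕ, CprecM a ∧ EndS a = {A} ∧
      Nat.Primrec (piOf a) ∧ IsOmegaProof (piOf a) ∧ CutFree (piOf a)) ∧
    ((∃ a : ℕ, CprecM a ∧ EndS a = {A}) → sentTrue A) := by
  constructor
  · intro hA
    obtain ⟨a, ha, ea, pa⟩ := exists_cprecM_of_sat A.1 [] hA ∅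
    rw [closeS_val, Finset.empty_union] at ea
    exact ⟨a, ha, ea, Primrec.nat_iff.1 pa, isOmegaProof_piOf ha, cutFree_piOf ha⟩
  · rintro ⟨a, ha, ea⟩
    simpa [ea, SeqTrue] using seqTrue_of_cprecM ha

end Shoen
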